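/- The root-distance on the set Res(X) of spherical residues of a building X is well defined and is a metric: (i) for spherical residues R₁,R₂ the cardinalities |Φ_A(R₁,R₂)| and |Φ_A(R₂,R₁)| do not depend on the choice of an apartment A in which R₁ and R₂ both lie, the root-distance is symmetric, vanishes exactly when R₁ = R₂, and satisfies the triangle inequality; (ii) for every apartment A and chamber x ∈ A, the retraction ρ_{A,x} onto A does not increase the root-distance: d(ρ_{A,x}(R₁), ρ_{A,x}(R₂)) ≤ d(R₁,R₂) for all spherical residues R₁,R₂. -/

import Mathlib

open Filter Topology

noncomputable section

variable {B : Type} {W : Type} [Group W] {M : CoxeterMatrix B}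

/-- The subset `I` of the simple reflections is of *spherical type* if the standard
parabolic subgroup `W_I` it generates is finite. -/
def SphType (cs : CoxeterSystem M W) (I : Set B) : Prop :=
  ((Subgroup.closure (cs.simple '' I) : Subgroup W) : Set W).Finite

/-- A building of type `(W,S)`, in the chamber-system (`W`-metric) approach:
a nonempty set of chambers with a Weyl-group-valued distance function `delta`. -/
structure Bldg (cs : CoxeterSystem M W) where
  Chamber : Type
  chamber_nonempty : Nonempty Chamber
  delta : Chamber → Chamber → W
  delta_eq_one_iff : ∀ C D, delta C D = 1 ↔ C = D
  delta_mem_pair : ∀ C D E (i : B), delta D E = cs.simple i →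
    delta C E = delta C D * cs.simple i ∨ delta C E = delta C D
  delta_eq_of_length : ∀ C D E (i : B), delta D E = cs.simple i →
    cs.length (delta C D * cs.simple i) = cs.length (delta C D) + 1 →
    delta C E = delta C D * cs.simple i
  exists_delta : ∀ C D (i : B), ∃ E, delta D E = cs.simple i ∧
    delta C E = delta C D * cs.simple i

namespace Bldg

variable {cs : CoxeterSystem M W} (X : Bldg cs)

instance : Nonempty X.Chamber := X.chamber_nonempty

instance : TopologicalSpace X.Chamber := ⊥
instance : DiscreteTopology X.Chamber := ⟨rfl⟩

/-- The gallery distance between two chambers. -/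
def gdist (C D : X.Chamber) : ℕ := cs.length (X.delta C D)

/-- The `I`-residue of the chamber `C`. -/
def residue (I : Set B) (C : X.Chamber) : Set X.Chamber :=
  {D | X.delta C D ∈ Subgroup.closure (cs.simple '' I)}

/-- `R` is a spherical residue. -/
def IsSphResidue (R : Set X.Chamber) : Prop :=
  ∃ (I : Set B) (C : X.Chamber), SphType cs I ∧ R = X.residue I C

/-- `R` is a panel, i.e. an `{s}`-residue. -/
def IsPanel (R : Set X.Chamber) : Prop :=
  ∃ (i : B) (C : X.Chamber), R = X.residue {i} C

/-- The set `Res(X)` of spherical residues of `X`. -/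
def Res : Type := {R : Set X.Chamber // X.IsSphResidue R}

/-- The set of panels of `X`. -/
def Panel : Type := {R : Set X.Chamber // X.IsPanel R}

instance : Nonempty X.Res := by
  obtain ⟨C⟩ := X.chamber_nonempty
  exact ⟨⟨X.residue ∅ C, ∅, C, by simp [SphType], rfl⟩⟩

instance : TopologicalSpace X.Res := ⊥
instance : DiscreteTopology X.Res := ⟨rfl⟩

/-- `R₁ ≤ R₂` : the spherical residue `R₂` contains `R₁`, i.e. `R₂ ⊆ R₁` as
sets of chambers. -/
def leRes (R₁ R₂ : X.Res) : Prop := R₂.1 ⊆ R₁.1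

/-- The star `St(σ)` of a spherical residue. -/
def star (σ : X.Res) : Set X.Res := {τ | X.leRes σ τ}

/-- The gate (combinatorial projection) of the chamber `C` onto the residue `R` :
the unique chamber of `R` through which pass minimal galleries from `C` to any
chamber of `R`. -/
def gate (R : Set X.Chamber) (C : X.Chamber) : X.Chamber :=
  Classical.epsilon fun D => D ∈ R ∧ ∀ E ∈ R, X.gdist C E = X.gdist C D + X.gdist D E

/-- The combinatorial projection of the residue `T` onto the residue `R`,
as a set of chambers. -/
def projSet (R T : Set X.Chamber) : Set X.Chamber := X.gate R '' T

/-- The combinatorial projection `proj_R(T)` of the spherical residue `T` onto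
the spherical residue `R`, as a spherical residue. -/
def projRes (R T : X.Res) : X.Res :=
  Classical.epsilon fun U : X.Res => U.1 = X.projSet R.1 T.1

/-- The map `proj_r : Res(X) → ∏_σ St(σ)` underlying the maximal combinatorial
bordification. -/
def projr (R : X.Res) : X.Res → X.Res := fun σ => X.projRes σ R

/-- The maximal combinatorial bordification `Cr(X)`: the closure of the image
of `proj_r`, each factor of the product being discrete. -/
def Cr : Set (X.Res → X.Res) := closure (Set.range X.projr)

/-- The map `proj_c : ch(X) → ∏_{σ panel} St(σ)` underlying the minimal
combinatorial bordification. -/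
def projc (C : X.Chamber) : X.Panel → X.Chamber := fun σ => X.gate σ.1 C

/-- The minimal combinatorial bordification `Cc(X)`. -/
def Cc : Set (X.Panel → X.Chamber) := closure (Set.range X.projc)

/-- A set of spherical residues is closed if it contains, with any residue,
all residues that it contains (in the order `leRes`). -/
def ClosedResSet (𝓡 : Set X.Res) : Prop :=
  ∀ R₁ R₂ : X.Res, X.leRes R₁ R₂ → R₂ ∈ 𝓡 → R₁ ∈ 𝓡

/-- A set of spherical residues is convex if it is closed and stable under
combinatorial projections. -/
def ConvexResSet (𝓡 : Set X.Res) : Prop :=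
  X.ClosedResSet 𝓡 ∧ ∀ R₁ ∈ 𝓡, ∀ R₂ ∈ 𝓡, X.projRes R₁ R₂ ∈ 𝓡

/-- The closure of a set of spherical residues. -/
def resClosure (𝓡 : Set X.Res) : Set X.Res := ⋂₀ {𝓢 | X.ClosedResSet 𝓢 ∧ 𝓡 ⊆ 𝓢}

/-- The convex hull of a set of spherical residues. -/
def convHull (𝓡 : Set X.Res) : Set X.Res := ⋂₀ {𝓢 | X.ConvexResSet 𝓢 ∧ 𝓡 ⊆ 𝓢}

/-- The convex hull `Conv(R₁,R₂)` of two spherical residues. -/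
def conv2 (R₁ R₂ : X.Res) : Set X.Res := X.convHull {R₁, R₂}

/-- `α : W → ch(X)` is an apartment map: an isometric embedding of the Coxeter
complex. -/
def IsApartMap (α : W → X.Chamber) : Prop :=
  Function.Injective α ∧ ∀ v w : W, X.delta (α v) (α w) = v⁻¹ * w

/-- `A` is an apartment of `X`. -/
def IsApartment (A : Set X.Chamber) : Prop :=
  ∃ α : W → X.Chamber, X.IsApartMap α ∧ A = Set.range α

/-- The residue `R` lies in the apartment `A`. -/
def LiesIn (R : X.Res) (A : Set X.Chamber) : Prop := (R.1 ∩ A).Nonempty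

/-- `φ` is a root (half-apartment) of the apartment `A`. -/
def IsRootOf (A φ : Set X.Chamber) : Prop :=
  ∃ α : W → X.Chamber, X.IsApartMap α ∧ A = Set.range α ∧
    ∃ t : W, cs.IsReflection t ∧ φ = α '' {v : W | cs.length v < cs.length (t * v)}

/-- The residue `R` is contained in the root `φ` of the apartment `A`. -/
def ContainedInRoot (R : X.Res) (A φ : Set X.Chamber) : Prop := R.1 ∩ A ⊆ φ

/-- `Φ_A(R₁,R₂)`: the set of roots of `A` containing `R₁` but not `R₂`. -/
def PhiSep (A : Set X.Chamber) (R₁ R₂ : X.Res) : Set (Set X.Chamber) :=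
  {φ | X.IsRootOf A φ ∧ X.ContainedInRoot R₁ A φ ∧ ¬ X.ContainedInRoot R₂ A φ}

/-- A choice of apartment in which both `R₁` and `R₂` lie. -/
def chooseApt (R₁ R₂ : X.Res) : Set X.Chamber :=
  Classical.epsilon fun A : Set X.Chamber => X.IsApartment A ∧ X.LiesIn R₁ A ∧ X.LiesIn R₂ A

/-- The root-distance between two spherical residues:
`d(R₁,R₂) = ½|Φ_A(R₁,R₂)| + ½|Φ_A(R₂,R₁)|` for an apartment `A` containing both. -/
def rootDist (R₁ R₂ : X.Res) : ℝ :=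
  (((X.PhiSep (X.chooseApt R₁ R₂) R₁ R₂).ncard +
    (X.PhiSep (X.chooseApt R₁ R₂) R₂ R₁).ncard : ℕ) : ℝ) / 2

/-- The interval `[R₁,R₂]` determined by two spherical residues. -/
def interval (R₁ R₂ : X.Res) : Set X.Res :=
  {σ | X.rootDist R₁ R₂ = X.rootDist R₁ σ + X.rootDist σ R₂}

/-- The retraction onto the apartment given by the apartment map `α`, centred at
the chamber `α 1`. -/
def retr (α : W → X.Chamber) (D : X.Chamber) : X.Chamber := α (X.delta (α 1) D)

/-- The retraction onto an apartment, acting on spherical residues: it maps the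
`I`-residue of a chamber `D` to the `I`-residue of the retracted chamber. -/
def retrRes (α : W → X.Chamber) (R : X.Res) : X.Res :=
  Classical.epsilon fun T : X.Res =>
    ∃ (I : Set B) (D : X.Chamber), R.1 = X.residue I D ∧ T.1 = X.residue I (X.retr α D)

/-- The sequence `(R_n)` of spherical residues converges to `ξ` in the maximal
combinatorial bordification. -/
def ConvSeq (ξ : X.Res → X.Res) (R : ℕ → X.Res) : Prop :=
  Tendsto (fun n => X.projr (R n)) atTop (nhds ξ)

/-- `Q(x, (R_n)) = ⋃_k ⋂_{n ≥ k} Conv(x, R_n)`. -/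
def Qseq (x : X.Res) (R : ℕ → X.Res) : Set X.Res :=
  ⋃ k : ℕ, ⋂ n : ℕ, ⋂ _ : k ≤ n, X.conv2 x (R n)

/-- The combinatorial sector `Q(x,ξ)` based at `x` and pointing towards `ξ`. -/
def Qsector (x : X.Res) (ξ : X.Res → X.Res) : Set X.Res :=
  X.Qseq x (Classical.epsilon (X.ConvSeq ξ))

/-- `Φ_A(ξ)`: the set of roots of the apartment `A` (with apartment map `α`) in
which every sequence of residues converging to `ξ`, retracted to `A`, eventually
lies. -/
def PhiXi (A : Set X.Chamber) (α : W → X.Chamber) (ξ : X.Res → X.Res) :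
    Set (Set X.Chamber) :=
  {φ | X.IsRootOf A φ ∧ ∀ R : ℕ → X.Res, X.ConvSeq ξ R →
    ∃ N : ℕ, ∀ n > N, X.ContainedInRoot (X.retrRes α (R n)) A φ}

/-- `Φ_A(x)`: the set of roots of `A` containing the residue `x`. -/
def PhiRes (A : Set X.Chamber) (x : X.Res) : Set (Set X.Chamber) :=
  {φ | X.IsRootOf A φ ∧ X.ContainedInRoot x A φ}

/-- The spherical residue `x` is a chamber (an `∅`-residue). -/
def IsChamberRes (x : X.Res) : Prop :=
  ∃ C : X.Chamber, x.1 = X.residue (∅ : Set B) C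

/-- The automorphism group of the building: all permutations of the chambers
preserving the Weyl distance. -/
def autGroup : Subgroup (Equiv.Perm X.Chamber) where
  carrier := {g | ∀ C D : X.Chamber, X.delta (g C) (g D) = X.delta C D}
  one_mem' := by intro C D; simp
  mul_mem' := by
    intro a b ha hb C D
    simp only [Equiv.Perm.mul_apply]
    rw [ha, hb]
  inv_mem' := by
    intro a ha C D
    have := ha (a⁻¹ C) (a⁻¹ D)
    simpa using this.symm

/-- `Aut(X)` as a type. -/
abbrev Aut : Type := ↥X.autGroup

/-- The topology of pointwise convergence on `Aut(X)` (the chamber set being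
discrete). -/
instance : TopologicalSpace X.Aut :=
  TopologicalSpace.induced
    (fun g : X.Aut => ((g : Equiv.Perm X.Chamber) : X.Chamber → X.Chamber)) inferInstance

/-- The action of an automorphism on spherical residues. -/
def actRes (g : X.Aut) (R : X.Res) : X.Res :=
  Classical.epsilon fun T : X.Res => T.1 = (g : Equiv.Perm X.Chamber) '' R.1

/-- The action of an automorphism on panels. -/
def actPanel (g : X.Aut) (σ : X.Panel) : X.Panel :=
  haveI : Nonempty X.Panel := ⟨σ⟩
  Classical.epsilon fun τ : X.Panel => τ.1 = (g : Equiv.Perm X.Chamber) '' σ.1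

/-- The action of `Aut(X)` on the maximal combinatorial bordification:
`(g·f)(σ) = g·f(g⁻¹σ)`. -/
def actCr (g : X.Aut) (f : X.Res → X.Res) : X.Res → X.Res :=
  fun σ => X.actRes g (f (X.actRes g⁻¹ σ))

/-- The action of `Aut(X)` on the minimal combinatorial bordification. -/
def actCc (g : X.Aut) (f : X.Panel → X.Chamber) : X.Panel → X.Chamber :=
  fun σ => (g : Equiv.Perm X.Chamber) (f (X.actPanel g⁻¹ σ))

/-- The building is locally finite: `S` is finite and panels are finite. -/
def LocallyFinite : Prop :=
  Finite B ∧ ∀ R : Set X.Chamber, X.IsPanel R → R.Finite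

/-- The building is thick: every panel contains at least three chambers. -/
def Thick : Prop := ∀ R : Set X.Chamber, X.IsPanel R → 3 ≤ R.ncard

/-- The subgroup `G ≤ Aut(X)` acts strongly transitively: transitively on pairs
`(C, A)` of a chamber contained in an apartment. -/
def StronglyTransitive (G : Subgroup X.Aut) : Prop :=
  ∀ (C C' : X.Chamber) (A A' : Set X.Chamber),
    X.IsApartment A → C ∈ A → X.IsApartment A' → C' ∈ A' →
    ∃ g ∈ G, (g : Equiv.Perm X.Chamber) C = C' ∧ (g : Equiv.Perm X.Chamber) '' A = A'

end Bldg

/-- A topological group is amenable if there is a left-invariant mean on the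
space of bounded continuous real-valued functions on it. -/
def IsAmenableGroup (H : Type*) [Group H] [TopologicalSpace H] : Prop :=
  ∃ m : BoundedContinuousFunction H ℝ →ₗ[ℝ] ℝ,
    m 1 = 1 ∧ (∀ f : BoundedContinuousFunction H ℝ, (∀ x, 0 ≤ f x) → 0 ≤ m f) ∧
    ∀ (g : H) (f₁ f₂ : BoundedContinuousFunction H ℝ),
      (∀ x, f₂ x = f₁ (g * x)) → m f₂ = m f₁

/-- A subset `K` of a topological group is topologically locally finite if every
finite subset of `K` generates a subgroup with compact closure. -/
def IsTLFSet {H : Type*} [Group H] [TopologicalSpace H] (K : Set H) : Prop :=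
  ∀ s : Finset H, (s : Set H) ⊆ K →
    IsCompact (closure ((Subgroup.closure (s : Set H) : Subgroup H) : Set H))

/-- The space of closed subgroups of a topological group. -/
def ChabautySpace (H : Type*) [Group H] [TopologicalSpace H] : Type _ :=
  {K : Subgroup H // IsClosed (K : Set H)}

instance {H : Type*} [Group H] [TopologicalSpace H] : Nonempty (ChabautySpace H) :=
  ⟨⟨⊤, by rw [Subgroup.coe_top]; exact isClosed_univ⟩⟩

/-- The Chabauty topology on the space of closed subgroups. -/
instance {H : Type*} [Group H] [TopologicalSpace H] : TopologicalSpace (ChabautySpace H) :=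
  TopologicalSpace.generateFrom
    ({s | ∃ K : Set H, IsCompact K ∧ s = {L : ChabautySpace H | (L.1 : Set H) ∩ K = ∅}} ∪
     {s | ∃ U : Set H, IsOpen U ∧ s = {L : ChabautySpace H | ((L.1 : Set H) ∩ U).Nonempty}})

namespace Bldg

variable {cs : CoxeterSystem M W} (X : Bldg cs)

/-- The stabiliser in `G` of a spherical residue, as a set. -/
def gstab (G : Subgroup X.Aut) (R : X.Res) : Set ↥G :=
  {g : ↥G | X.actRes (g : X.Aut) R = R}

/-- The stabiliser in `G` of a spherical residue, as a closed subgroup of `G`. -/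
def gstabC (G : Subgroup X.Aut) (R : X.Res) : ChabautySpace ↥G :=
  Classical.epsilon fun L : ChabautySpace ↥G => (L.1 : Set ↥G) = X.gstab G R

/-- `D_ξ`: the union over `x ∈ Res(X)` of the pointwise fixators in `G` of the
combinatorial sectors `Q(x,ξ)`. -/
def gfixSector (G : Subgroup X.Aut) (ξ : X.Res → X.Res) : Set ↥G :=
  {g : ↥G | ∃ x : X.Res, ∀ R ∈ X.Qsector x ξ, X.actRes (g : X.Aut) R = R}

/-- `D_ξ` as a closed subgroup of `G` (an element of the Chabauty space). -/
def DxiC (G : Subgroup X.Aut) (ξ : X.Res → X.Res) : ChabautySpace ↥G :=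
  Classical.epsilon fun L : ChabautySpace ↥G => (L.1 : Set ↥G) = X.gfixSector G ξ

/-- The set of periodic elements of the stabiliser `G_ξ`. -/
def periodicStab (G : Subgroup X.Aut) (ξ : X.Res → X.Res) : Set ↥G :=
  {g : ↥G | X.actCr (g : X.Aut) ξ = ξ ∧
    IsCompact (closure ((Subgroup.zpowers g : Subgroup ↥G) : Set ↥G))}

/-- The horofunction compactification of the chamber graph, with base point `y₀`. -/
def horoCh (y₀ : X.Chamber) : Set (X.Chamber → ℝ) :=
  closure (Set.range fun C : X.Chamber =>
    fun y : X.Chamber => (X.gdist C y : ℝ) - (X.gdist C y₀ : ℝ))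

/-- The horofunction compactification of `(Res(X), root-distance)`, with base
point `z₀`. -/
def horoRes (z₀ : X.Res) : Set (X.Res → ℝ) :=
  closure (Set.range fun R : X.Res =>
    fun y : X.Res => X.rootDist R y - X.rootDist R z₀)

/-- The action of `Aut(X)` on horofunctions of the chamber graph. -/
def actHoroCh (y₀ : X.Chamber) (g : X.Aut) (h : X.Chamber → ℝ) : X.Chamber → ℝ :=
  fun y => h (((g⁻¹ : X.Aut) : Equiv.Perm X.Chamber) y) -
    h (((g⁻¹ : X.Aut) : Equiv.Perm X.Chamber) y₀)

/-- The action of `Aut(X)` on horofunctions of `(Res(X), root-distance)`. -/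
def actHoroRes (z₀ : X.Res) (g : X.Aut) (h : X.Res → ℝ) : X.Res → ℝ :=
  fun y => h (X.actRes g⁻¹ y) - h (X.actRes g⁻¹ z₀)

end Bldg

namespace CoxeterSystem

variable (cs : CoxeterSystem M W)

open Classical in
/-- The involution `(t, ε) ↦ (s t s, ε + [t = s])` of `W × ℤ/2` attached to a simple
reflection `s`. -/
def signPerm (i : B) : Equiv.Perm (W × ZMod 2) :=
  Function.Involutive.toPerm
    (fun p => (cs.simple i * p.1 * cs.simple i, p.2 + if p.1 = cs.simple i then 1 else 0)) (by
      rintro ⟨t, e⟩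
      have h : cs.simple i * t * cs.simple i = cs.simple i ↔ t = cs.simple i := by
        constructor
        · intro h
          have := congrArg (fun x => cs.simple i * x * cs.simple i) h
          simpa [mul_assoc] using this
        · rintro rfl; simp
      ext
      · simp [mul_assoc]
      · simp only [h, add_assoc]
        split_ifs <;> simp [CharTwo.add_self_eq_zero])

open Classical in
theorem signPerm_apply (i : B) (t : W) (e : ZMod 2) :
    cs.signPerm i (t, e) =
      (cs.simple i * t * cs.simple i, e + if t = cs.simple i then 1 else 0) := rfl

open Classical in
theorem signPerm_mul_pow_apply (i j : B) (k : ℕ) (t : W) (e : ZMod 2) :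
    ((cs.signPerm i * cs.signPerm j) ^ k) (t, e) =
      ((cs.simple i * cs.simple j) ^ k * t * (cs.simple j * cs.simple i) ^ k,
        e + ∑ n ∈ Finset.range (2 * k),
          if t = (cs.simple j * cs.simple i) ^ n * cs.simple j then 1 else 0) := by
  induction k with
  | zero => simp
  | succ k ih =>
    have hinv : ((cs.simple j * cs.simple i) ^ k)⁻¹ = (cs.simple i * cs.simple j) ^ k := by
      rw [← inv_pow]; simp
    have hconj : cs.simple j * (cs.simple i * cs.simple j) ^ k =
        (cs.simple j * cs.simple i) ^ k * cs.simple j := by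
      have : SemiconjBy (cs.simple j) (cs.simple i * cs.simple j)
          (cs.simple j * cs.simple i) := by simp [SemiconjBy, mul_assoc]
      exact this.pow_right k
    have key : ∀ x : W, (cs.simple i * cs.simple j) ^ k * t * (cs.simple j * cs.simple i) ^ k = x ↔
        t = (cs.simple j * cs.simple i) ^ k * x * (cs.simple i * cs.simple j) ^ k := by
      intro x
      rw [← hinv]
      constructor
      · rintro rfl; group
      · rintro rfl; group
    have h1 : (cs.simple i * cs.simple j) ^ k * t * (cs.simple j * cs.simple i) ^ k = cs.simple j ↔
        t = (cs.simple j * cs.simple i) ^ (2 * k) * cs.simple j := by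
      rw [key, mul_assoc, hconj, ← mul_assoc, ← pow_add, two_mul]
    have h2 : cs.simple j * ((cs.simple i * cs.simple j) ^ k * t *
          (cs.simple j * cs.simple i) ^ k) * cs.simple j = cs.simple i ↔
        t = (cs.simple j * cs.simple i) ^ (2 * k + 1) * cs.simple j := by
      have : cs.simple j * ((cs.simple i * cs.simple j) ^ k * t *
          (cs.simple j * cs.simple i) ^ k) * cs.simple j = cs.simple i ↔
          (cs.simple i * cs.simple j) ^ k * t * (cs.simple j * cs.simple i) ^ k =
            cs.simple j * cs.simple i * cs.simple j := by
        generalize (cs.simple i * cs.simple j) ^ k * t * (cs.simple j * cs.simple i) ^ k = y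
        constructor
        · intro h
          rw [← h]; simp [mul_assoc]
        · rintro rfl
          simp [mul_assoc]
      rw [this, key, mul_assoc _ _ ((cs.simple i * cs.simple j) ^ k),
        mul_assoc _ _ ((cs.simple i * cs.simple j) ^ k), hconj, ← mul_assoc, ← mul_assoc,
        ← pow_succ, ← pow_add]
      congr! 3
      ring
    rw [pow_succ', Equiv.Perm.mul_apply, ih, Equiv.Perm.mul_apply, signPerm_apply, signPerm_apply]
    ext
    · simp only [pow_succ' (cs.simple i * cs.simple j), pow_succ (cs.simple j * cs.simple i)]
      simp only [mul_assoc]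
    · simp only [h1, h2, mul_add, mul_one, Finset.sum_range_succ, add_assoc]

theorem isLiftable_signPerm : M.IsLiftable cs.signPerm := by
  classical
  intro i j
  have hr : (cs.simple i * cs.simple j) ^ M i j = 1 := cs.simple_mul_simple_pow i j
  have hr' : (cs.simple j * cs.simple i) ^ M i j = 1 := cs.simple_mul_simple_pow' i j
  ext1 ⟨t, e⟩
  rw [signPerm_mul_pow_apply, hr, hr', two_mul, Finset.sum_range_add]
  simp only [pow_add, hr', one_mul, CharTwo.add_self_eq_zero]
  simp

/-- The action of `W` on `W × ℤ/2` which records the parity of the inversions. -/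
def signHom : W →* Equiv.Perm (W × ZMod 2) := cs.lift ⟨cs.signPerm, cs.isLiftable_signPerm⟩

/-- The parity of the number of occurrences of `t` in the right inversion sequence of any word
for `w`. -/
def invParity (w t : W) : ZMod 2 := (cs.signHom w (t, 0)).2

theorem signHom_simple (i : B) : cs.signHom (cs.simple i) = cs.signPerm i :=
  cs.lift_apply_simple cs.isLiftable_signPerm i

theorem signHom_apply (w t : W) (e : ZMod 2) :
    cs.signHom w (t, e) = (w * t * w⁻¹, e + cs.invParity w t) := by
  induction w using cs.simple_induction_left generalizing t e with
  | one => simp [invParity]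
  | mul_simple_left w i ih =>
    rw [invParity, map_mul, Equiv.Perm.mul_apply, Equiv.Perm.mul_apply, ih, ih t 0,
      signHom_simple, signPerm_apply, signPerm_apply]
    simp [mul_assoc, add_assoc]

theorem invParity_mul (v w t : W) :
    cs.invParity (v * w) t = cs.invParity w t + cs.invParity v (w * t * w⁻¹) := by
  rw [invParity, map_mul, Equiv.Perm.mul_apply, signHom_apply, signHom_apply]
  simp

open Classical in
theorem invParity_simple (i : B) (t : W) :
    cs.invParity (cs.simple i) t = if t = cs.simple i then 1 else 0 := by
  rw [invParity, signHom_simple, signPerm_apply]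
  simp

theorem invParity_one (t : W) : cs.invParity 1 t = 0 := by simp [invParity]

theorem invParity_self {t : W} (ht : cs.IsReflection t) : cs.invParity t t = 1 := by
  obtain ⟨w, i, rfl⟩ := ht
  have h := cs.invParity_mul w w⁻¹ (w * cs.simple i * w⁻¹)
  rw [mul_inv_cancel, invParity_one] at h
  rw [invParity_mul, invParity_mul]
  have e1 : w⁻¹ * (w * cs.simple i * w⁻¹) * w⁻¹⁻¹ = cs.simple i := by group
  rw [e1] at h ⊢
  have e2 : cs.simple i * cs.simple i * (cs.simple i)⁻¹ = cs.simple i := by group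
  rw [e2, invParity_simple, if_pos rfl, add_left_comm, ← h, add_zero]

theorem mem_rightInvSeq_of_invParity_ne_zero (ω : List B) (t : W)
    (h : cs.invParity (cs.wordProd ω) t ≠ 0) : t ∈ cs.rightInvSeq ω := by
  induction ω with
  | nil => simp [invParity_one] at h
  | cons i ω ih =>
    rw [rightInvSeq, List.mem_cons]
    by_cases h0 : cs.invParity (cs.wordProd ω) t = 0
    · left
      rw [wordProd_cons, invParity_mul, h0, zero_add, invParity_simple] at h
      have : cs.wordProd ω * t * (cs.wordProd ω)⁻¹ = cs.simple i := by
        by_contra h'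
        simp [h'] at h
      rw [← this]; group
    · exact Or.inr (ih h0)

theorem invParity_ne_zero_iff {w t : W} (ht : cs.IsReflection t) :
    cs.invParity w t ≠ 0 ↔ cs.length (w * t) < cs.length w := by
  have key : ∀ w, cs.invParity w t ≠ 0 → cs.length (w * t) < cs.length w := by
    intro w h
    obtain ⟨ω, hω, rfl⟩ := cs.exists_isReduced w
    exact (cs.isRightInversion_of_mem_rightInvSeq hω
      (cs.mem_rightInvSeq_of_invParity_ne_zero ω t h)).2
  refine ⟨key w, fun hlt h0 => ?_⟩
  have h1 : cs.invParity (w * t) t ≠ 0 := by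
    rw [invParity_mul, cs.invParity_self ht, mul_inv_cancel_right, h0]
    decide
  have := key _ h1
  rw [mul_assoc, ht.mul_self, mul_one] at this
  omega

/-- The strong exchange condition. -/
theorem mem_leftInvSeq_of_length_lt {ω : List B} {t : W} (ht : cs.IsReflection t)
    (h : cs.length (t * cs.wordProd ω) < cs.length (cs.wordProd ω)) : t ∈ cs.leftInvSeq ω := by
  have hpar : cs.invParity (cs.wordProd ω.reverse) t ≠ 0 := by
    rw [cs.invParity_ne_zero_iff ht, wordProd_reverse, length_inv, ← length_inv]
    simpa [ht.inv] using h
  simpa [rightInvSeq_reverse] using cs.mem_rightInvSeq_of_invParity_ne_zero _ t hpar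

/-- Whether the wall of the reflection `t` separates `1` from `w`. -/
def leftInv (w t : W) : Bool := decide (cs.length (t * w) < cs.length w)

theorem leftInv_eq_true_iff {w t : W} :
    cs.leftInv w t = true ↔ cs.length (t * w) < cs.length w := by simp [leftInv]

theorem leftInv_eq_decide {w t : W} (ht : cs.IsReflection t) :
    cs.leftInv w t = decide (cs.invParity w⁻¹ t ≠ 0) := by
  rw [leftInv, decide_eq_decide, cs.invParity_ne_zero_iff ht, length_inv, ← length_inv (w := t * w)]
  simp [ht.inv]

theorem leftInv_mul {t : W} (ht : cs.IsReflection t) (v w : W) :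
    cs.leftInv (v * w) t = (cs.leftInv v t ^^ cs.leftInv w (v⁻¹ * t * v)) := by
  have ht' : cs.IsReflection (v⁻¹ * t * v) := by simpa using ht.conj v⁻¹
  rw [cs.leftInv_eq_decide ht, cs.leftInv_eq_decide ht, cs.leftInv_eq_decide ht', mul_inv_rev,
    invParity_mul, inv_inv]
  generalize cs.invParity v⁻¹ t = a
  generalize cs.invParity w⁻¹ _ = b
  revert a b
  decide

end CoxeterSystem

namespace CoxeterSystem

variable (cs : CoxeterSystem M W)

theorem leftInv_one {t : W} (ht : cs.IsReflection t) : cs.leftInv 1 t = false := by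
  have h := cs.leftInv_mul ht 1 1
  rw [mul_one] at h
  simpa using h

theorem leftInv_self {t : W} (ht : cs.IsReflection t) : cs.leftInv t t = true := by
  rw [leftInv_eq_true_iff, ht.mul_self, length_one]
  exact ht.odd_length.pos

/-- The wall of `t` separates `v` and `w` if and only if the reflection `v⁻¹ t v` is an inversion
of `v⁻¹ w`. -/
theorem leftInv_ne_iff {t : W} (ht : cs.IsReflection t) (v w : W) :
    cs.leftInv v t ≠ cs.leftInv w t ↔ cs.length (v⁻¹ * t * w) < cs.length (v⁻¹ * w) := by
  have h := cs.leftInv_mul ht v (v⁻¹ * w)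
  rw [mul_inv_cancel_left] at h
  have h2 : v⁻¹ * t * w = (v⁻¹ * t * v) * (v⁻¹ * w) := by group
  rw [h2, ← leftInv_eq_true_iff, h]
  cases cs.leftInv v t <;> cases cs.leftInv (v⁻¹ * w) (v⁻¹ * t * v) <;> simp

theorem finite_inversions (w : W) : {t | cs.IsLeftInversion w t}.Finite := by
  obtain ⟨ω, -, rfl⟩ := cs.exists_isReduced w
  exact (cs.leftInvSeq ω).finite_toSet.subset fun t ht => cs.mem_leftInvSeq_of_length_lt ht.1 ht.2

theorem ncard_inversions (w : W) : {t | cs.IsLeftInversion w t}.ncard = cs.length w := by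
  classical
  obtain ⟨ω, hω, rfl⟩ := cs.exists_isReduced w
  have h : {t | cs.IsLeftInversion (cs.wordProd ω) t} = ((cs.leftInvSeq ω).toFinset : Set W) := by
    ext t
    simp only [Set.mem_ofPred_eq, List.coe_toFinset]
    exact ⟨fun ht => cs.mem_leftInvSeq_of_length_lt ht.1 ht.2,
      fun ht => cs.isLeftInversion_of_mem_leftInvSeq hω ht⟩
  rw [h, Set.ncard_coe_finset, List.toFinset_card_of_nodup hω.nodup_leftInvSeq,
    length_leftInvSeq, hω.eq]

/-- The walls separating `v` from `w`. -/
def sepWalls (v w : W) : Set W := {t | cs.IsReflection t ∧ cs.leftInv v t ≠ cs.leftInv w t}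

theorem sepWalls_eq_image (v w : W) :
    cs.sepWalls v w = (MulAut.conj v) '' {t | cs.IsLeftInversion (v⁻¹ * w) t} := by
  ext t
  constructor
  · rintro ⟨ht, h⟩
    refine ⟨v⁻¹ * t * v, ⟨by simpa using ht.conj v⁻¹, ?_⟩, by simp [mul_assoc]⟩
    rw [cs.leftInv_ne_iff ht] at h
    simpa [mul_assoc] using h
  · rintro ⟨r, ⟨hr, h⟩, rfl⟩
    have ht : cs.IsReflection (v * r * v⁻¹) := hr.conj v
    refine ⟨by simpa using ht, ?_⟩
    rw [MulAut.conj_apply, cs.leftInv_ne_iff ht]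
    simpa [mul_assoc] using h

theorem finite_sepWalls (v w : W) : (cs.sepWalls v w).Finite := by
  rw [sepWalls_eq_image]
  exact (cs.finite_inversions _).image _

theorem ncard_sepWalls (v w : W) : (cs.sepWalls v w).ncard = cs.length (v⁻¹ * w) := by
  rw [sepWalls_eq_image, Set.ncard_image_of_injective _ (MulAut.conj v).injective,
    ncard_inversions]

/-! ### Standard parabolic subgroups -/

/-- The standard parabolic subgroup `W_I`. -/
abbrev parabolic (I : Set B) : Subgroup W := Subgroup.closure (cs.simple '' I)

theorem exists_word_of_mem_parabolic {I : Set B} {u : W} (hu : u ∈ cs.parabolic I) :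
    ∃ ω : List B, (∀ i ∈ ω, i ∈ I) ∧ cs.wordProd ω = u := by
  induction hu using Subgroup.closure_induction with
  | mem x hx =>
    obtain ⟨i, hi, rfl⟩ := hx
    exact ⟨[i], by simpa using hi, by simp⟩
  | one => exact ⟨[], by simp, by simp⟩
  | mul x y _ _ hx hy =>
    obtain ⟨ω, h, rfl⟩ := hx
    obtain ⟨ω', h', rfl⟩ := hy
    refine ⟨ω ++ ω', fun i hi => ?_, by simp [wordProd_append]⟩
    rcases List.mem_append.1 hi with hi | hi
    exacts [h i hi, h' i hi]
  | inv x _ hx =>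
    obtain ⟨ω, h, rfl⟩ := hx
    exact ⟨ω.reverse, by simpa using h, by simp [wordProd_reverse]⟩

theorem mem_parabolic_of_mem_leftInvSeq {I : Set B} {ω : List B} (hω : ∀ i ∈ ω, i ∈ I) {t : W}
    (ht : t ∈ cs.leftInvSeq ω) : t ∈ cs.parabolic I := by
  induction ω generalizing t with
  | nil => simp at ht
  | cons i ω ih =>
    have hi : cs.simple i ∈ cs.parabolic I :=
      Subgroup.subset_closure ⟨i, hω i (by simp), rfl⟩
    rw [leftInvSeq, List.mem_cons, List.mem_map] at ht
    rcases ht with rfl | ⟨r, hr, rfl⟩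
    · exact hi
    · have := ih (fun j hj => hω j (by simp [hj])) hr
      rw [MulAut.conj_apply]
      exact mul_mem (mul_mem hi this) (inv_mem hi)

/-- The reflections whose walls separate `1` from an element of `W_I` lie in `W_I`. -/
theorem mem_parabolic_of_length_lt {I : Set B} {u t : W} (hu : u ∈ cs.parabolic I)
    (ht : cs.IsReflection t) (h : cs.length (t * u) < cs.length u) : t ∈ cs.parabolic I := by
  obtain ⟨ω, hω, rfl⟩ := cs.exists_word_of_mem_parabolic hu
  exact cs.mem_parabolic_of_mem_leftInvSeq hω (cs.mem_leftInvSeq_of_length_lt ht h)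

theorem simple_mem_parabolic_of_isRightDescent {I : Set B} {u : W} {i : B}
    (hu : u ∈ cs.parabolic I) (h : cs.IsRightDescent u i) : cs.simple i ∈ cs.parabolic I := by
  refine cs.mem_parabolic_of_length_lt (inv_mem hu) (cs.isReflection_simple i) ?_
  exact cs.isLeftDescent_inv_iff.2 h

/-- Additivity of the length for a minimal representative of a coset of `W_I`. -/
theorem length_mul_of_minimal {I : Set B} {w : W}
    (hw : ∀ u ∈ cs.parabolic I, cs.length w ≤ cs.length (w * u)) {u : W}
    (hu : u ∈ cs.parabolic I) : cs.length (w * u) = cs.length w + cs.length u := by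
  induction hn : cs.length u generalizing u with
  | zero => rw [cs.length_eq_zero_iff] at hn; simp [hn]
  | succ n ih =>
    obtain ⟨i, hi⟩ := cs.exists_rightDescent_of_ne_one (w := u) (by rintro rfl; simp at hn)
    have hs := cs.simple_mem_parabolic_of_isRightDescent hu hi
    obtain ⟨u', rfl⟩ : ∃ u', u = u' * cs.simple i := ⟨u * cs.simple i, by simp⟩
    have hu' : u' ∈ cs.parabolic I := by simpa using mul_mem hu hs
    have hlen := cs.isRightDescent_iff.1 hi
    rw [simple_mul_simple_cancel_right] at hlen
    have hrs := cs.isReflection_simple i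
    have hr : u' * cs.simple i * u'⁻¹ ∈ cs.parabolic I :=
      mul_mem (mul_mem hu' hs) (inv_mem hu')
    have h0 : cs.invParity u' (cs.simple i) = 0 := by
      by_contra h
      have := (cs.invParity_ne_zero_iff hrs).1 h
      omega
    have h1 : cs.invParity w (u' * cs.simple i * u'⁻¹) = 0 := by
      by_contra h
      have := (cs.invParity_ne_zero_iff (hrs.conj u')).1 h
      have := hw _ hr
      omega
    have h2 : ¬ cs.length (w * u' * cs.simple i) < cs.length (w * u') := by
      rw [← cs.invParity_ne_zero_iff hrs, invParity_mul, h0, h1]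
      simp
    have h3 := ih hu' (by omega)
    rcases cs.length_mul_simple (w * u') i with h | h
    · rw [← mul_assoc, h, h3]; ring
    · omega

/-- A finite standard parabolic subgroup has an element lying on the other side of all its walls
from `1`. -/
theorem exists_longest {I : Set B} (hI : SphType cs I) :
    ∃ w ∈ cs.parabolic I, ∀ t ∈ cs.parabolic I, cs.IsReflection t →
      cs.length (t * w) < cs.length w := by
  obtain ⟨w, hw, hmax⟩ := Set.exists_max_image _ cs.length hI ⟨1, one_mem (cs.parabolic I)⟩
  refine ⟨w, hw, fun t ht hr => lt_of_le_of_ne ?_ (hr.length_mul_right_ne w)⟩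
  exact hmax _ (mul_mem (s := cs.parabolic I) ht hw)

theorem exists_minimal (P : Subgroup W) (w : W) :
    ∃ u ∈ P, ∀ v ∈ P, cs.length (w * u) ≤ cs.length (w * u * v) := by
  have hne : {n | ∃ u ∈ P, cs.length (w * u) = n}.Nonempty := ⟨_, 1, one_mem P, rfl⟩
  obtain ⟨u, hu, h⟩ := Nat.sInf_mem hne
  refine ⟨u, hu, fun v hv => ?_⟩
  rw [h, mul_assoc]
  exact Nat.sInf_le ⟨u * v, mul_mem hu hv, rfl⟩

/-! ### Half-spaces of the Coxeter complex -/

/-- One of the two sides of the wall of `t`. -/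
def halfSpace (t : W) (c : Bool) : Set W := {v | cs.leftInv v t = c}

/-- `H` is a half-space of `W`. -/
def IsHalfSpace (H : Set W) : Prop := ∃ t c, cs.IsReflection t ∧ H = cs.halfSpace t c

theorem isHalfSpace_iff_exists_translate (H : Set W) :
    cs.IsHalfSpace H ↔
      ∃ g t, cs.IsReflection t ∧ H = {v | cs.length (g * v) < cs.length (t * (g * v))} := by
  have key : ∀ {t : W}, cs.IsReflection t → ∀ v,
      cs.length v < cs.length (t * v) ↔ cs.leftInv v t = false := by
    intro t ht v
    have := ht.length_mul_right_ne v
    simp only [leftInv, decide_eq_false_iff_not]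
    omega
  constructor
  · rintro ⟨t, c, ht, rfl⟩
    cases c with
    | false => exact ⟨1, t, ht, by ext v; simp [key ht, halfSpace]⟩
    | true =>
      refine ⟨t, t, ht, ?_⟩
      ext v
      simp [key ht, halfSpace, cs.leftInv_mul ht t v, cs.leftInv_self ht]
  · rintro ⟨g, t, ht, rfl⟩
    refine ⟨g⁻¹ * t * g, cs.leftInv g t, by simpa using ht.conj g⁻¹, ?_⟩
    ext v
    change cs.length (g * v) < _ ↔ cs.leftInv v _ = cs.leftInv g t
    rw [key ht, cs.leftInv_mul ht]
    cases cs.leftInv g t <;> cases cs.leftInv v (g⁻¹ * t * g) <;> simp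

theorem IsHalfSpace.translate {H : Set W} (hH : cs.IsHalfSpace H) (g : W) :
    cs.IsHalfSpace ((g * ·) ⁻¹' H) := by
  rw [isHalfSpace_iff_exists_translate] at hH ⊢
  obtain ⟨k, t, ht, rfl⟩ := hH
  exact ⟨k * g, t, ht, by ext v; simp [mul_assoc]⟩

theorem halfSpace_injective {t t' : W} {c c' : Bool} (ht : cs.IsReflection t)
    (ht' : cs.IsReflection t') (h : cs.halfSpace t c = cs.halfSpace t' c') : t = t' ∧ c = c' := by
  have hiff : ∀ v, cs.leftInv v t = c ↔ cs.leftInv v t' = c' := fun v => Set.ext_iff.1 h v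
  have h1 := hiff 1
  rw [cs.leftInv_one ht, cs.leftInv_one ht'] at h1
  have hc : c = c' := by revert h1; cases c <;> cases c' <;> simp
  subst hc
  refine ⟨?_, rfl⟩
  have heq : ∀ v, cs.leftInv v t = cs.leftInv v t' := by
    intro v
    have := hiff v
    revert this
    cases c <;> cases cs.leftInv v t <;> cases cs.leftInv v t' <;> simp
  have hself : cs.leftInv t t' = true := by rw [← heq, cs.leftInv_self ht]
  obtain ⟨u, i, rfl⟩ := ht
  have hne : cs.leftInv u (u * cs.simple i * u⁻¹) ≠
      cs.leftInv (u * cs.simple i) (u * cs.simple i * u⁻¹) := by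
    rw [cs.leftInv_ne_iff ⟨u, i, rfl⟩]
    simp [mul_assoc]
  rw [heq, heq, cs.leftInv_ne_iff ht', inv_mul_cancel_left, length_simple, Nat.lt_one_iff,
    length_eq_zero_iff] at hne
  have h2 : t' = u * (cs.simple i)⁻¹ * u⁻¹ := by
    calc t' = u * (u⁻¹ * t' * (u * cs.simple i)) * (cs.simple i)⁻¹ * u⁻¹ := by group
      _ = u * (cs.simple i)⁻¹ * u⁻¹ := by rw [hne, mul_one]
  simpa using h2.symm

end CoxeterSystem

namespace CoxeterSystem

variable (cs : CoxeterSystem M W)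

/-- The half-spaces containing `Y` but not `Z`. -/
def halfSep (Y Z : Set W) : Set (Set W) := {H | cs.IsHalfSpace H ∧ Y ⊆ H ∧ ¬ Z ⊆ H}

theorem finite_halfSep {Y Z : Set W} (hY : Y.Nonempty) (hZ : Z.Finite) :
    (cs.halfSep Y Z).Finite := by
  obtain ⟨y, hy⟩ := hY
  have hfin : (⋃ z ∈ Z, (fun p : W × Bool => cs.halfSpace p.1 p.2) ''
      (cs.sepWalls y z ×ˢ Set.univ)).Finite :=
    hZ.biUnion fun z _ => ((cs.finite_sepWalls y z).prod Set.finite_univ).image _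
  refine hfin.subset ?_
  rintro H ⟨⟨t, c, ht, rfl⟩, hYH, hZH⟩
  obtain ⟨z, hz, hzH⟩ := Set.not_subset.1 hZH
  have hyc : cs.leftInv y t = c := hYH hy
  have hzc : cs.leftInv z t ≠ c := hzH
  exact Set.mem_biUnion hz ⟨(t, c), ⟨⟨ht, fun h => hzc (h ▸ hyc)⟩, Set.mem_univ _⟩, rfl⟩

theorem ncard_halfSep_triangle {X Y Z : Set W} (hX : X.Nonempty) (hY : Y.Nonempty)
    (hY' : Y.Finite) (hZ : Z.Finite) :
    (cs.halfSep X Z).ncard ≤ (cs.halfSep X Y).ncard + (cs.halfSep Y Z).ncard := by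
  refine le_trans (Set.ncard_le_ncard ?_
    ((cs.finite_halfSep hX hY').union (cs.finite_halfSep hY hZ))) (Set.ncard_union_le _ _)
  rintro H ⟨hH, hXH, hZH⟩
  by_cases h : Y ⊆ H
  exacts [Or.inr ⟨hH, h, hZH⟩, Or.inl ⟨hH, hXH, h⟩]

theorem ncard_halfSep_translate (g : W) (Y Z : Set W) :
    (cs.halfSep ((g * ·) '' Y) ((g * ·) '' Z)).ncard = (cs.halfSep Y Z).ncard := by
  have hg : Function.Bijective (g * · : W → W) := Group.mulLeft_bijective g
  rw [← Set.ncard_image_of_injective _ hg.surjective.preimage_injective]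
  congr 1
  ext H
  constructor
  · rintro ⟨K, ⟨hK, hY, hZ⟩, rfl⟩
    exact ⟨hK.translate cs g, Set.image_subset_iff.1 hY, fun h => hZ (Set.image_subset_iff.2 h)⟩
  · rintro ⟨hH, hY, hZ⟩
    have he : (g * ·) ⁻¹' ((g⁻¹ * ·) ⁻¹' H) = H := by ext; simp
    refine ⟨(g⁻¹ * ·) ⁻¹' H, ⟨hH.translate cs g⁻¹, ?_, ?_⟩, he⟩
    · rwa [Set.image_subset_iff, he]
    · rwa [Set.image_subset_iff, he]

/-- The left coset `g P`, as a set. -/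
def lcoset (P : Subgroup W) (g : W) : Set W := {v | g⁻¹ * v ∈ P}

theorem mem_lcoset {P : Subgroup W} {g v : W} : v ∈ lcoset P g ↔ g⁻¹ * v ∈ P := Iff.rfl

/-- Twice the root-distance between two subsets of `W`. -/
def halfDist (Y Z : Set W) : ℕ := (cs.halfSep Y Z).ncard + (cs.halfSep Z Y).ncard

/-- `w` is an element of `W_I` opposite to `1`. -/
def IsOpp (I : Set B) (w : W) : Prop :=
  w ∈ cs.parabolic I ∧ ∀ t ∈ cs.parabolic I, cs.IsReflection t → cs.length (t * w) < cs.length w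

theorem leftInv_eq_of_mem_lcoset {I : Set B} {w g v t : W} (hw : cs.IsOpp I w)
    (ht : cs.IsReflection t) (hv : v ∈ lcoset (cs.parabolic I) g)
    (h : cs.leftInv (g * w) t = cs.leftInv g t) : cs.leftInv v t = cs.leftInv g t := by
  by_contra hne
  have ht' : cs.IsReflection (g⁻¹ * t * g) := by simpa using ht.conj g⁻¹
  have h1 := (cs.leftInv_ne_iff ht g v).1 (Ne.symm hne)
  have h2 : g⁻¹ * t * g ∈ cs.parabolic I :=
    cs.mem_parabolic_of_length_lt hv ht' (by simpa [mul_assoc] using h1)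
  have h3 := hw.2 _ h2 ht'
  refine (cs.leftInv_ne_iff ht g (g * w)).2 ?_ h.symm
  simpa [mul_assoc] using h3

theorem lcoset_subset_halfSpace_iff {I : Set B} {w g t : W} {c : Bool} (hw : cs.IsOpp I w)
    (ht : cs.IsReflection t) :
    lcoset (cs.parabolic I) g ⊆ cs.halfSpace t c ↔
      cs.leftInv g t = c ∧ cs.leftInv (g * w) t = c := by
  constructor
  · intro h
    exact ⟨h (by simp [lcoset]), h (by simpa [lcoset] using hw.1)⟩
  · rintro ⟨h1, h2⟩ v hv
    exact (cs.leftInv_eq_of_mem_lcoset hw ht hv (h2.trans h1.symm)).trans h1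

section counting

open Classical in
theorem ncard_eq_sum {α : Type*} {S : Set α} {T : Finset α} (h : S ⊆ T) :
    S.ncard = ∑ t ∈ T, if t ∈ S then 1 else 0 := by
  rw [Finset.sum_boole, ← Set.ncard_coe_finset]
  congr 1
  ext x
  simpa using fun hx => h hx

variable {I J : Set B} {w w' g h : W}

/-- The number of half-spaces bounded by a given wall which contain a first residue but not a
second one; the arguments tell the sides of pairs of opposite chambers. -/
def wallCount (a a' b b' : Bool) : ℕ :=
  ∑ c : Bool, if (a = c ∧ a' = c) ∧ ¬ (b = c ∧ b' = c) then 1 else 0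

open Classical in
theorem ncard_halfSep_lcoset (hw : cs.IsOpp I w) (hw' : cs.IsOpp J w') {T : Finset W}
    (hT : ∀ t ∈ T, cs.IsReflection t) (hsub : cs.sepWalls g h ⊆ T)
    (hsub' : cs.sepWalls g (h * w') ⊆ T) :
    (cs.halfSep (lcoset (cs.parabolic I) g) (lcoset (cs.parabolic J) h)).ncard =
      ∑ t ∈ T, wallCount (cs.leftInv g t) (cs.leftInv (g * w) t) (cs.leftInv h t)
        (cs.leftInv (h * w') t) := by
  set S : Set (W × Bool) := {p | cs.IsReflection p.1 ∧
    ((cs.leftInv g p.1 = p.2 ∧ cs.leftInv (g * w) p.1 = p.2) ∧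
      ¬ (cs.leftInv h p.1 = p.2 ∧ cs.leftInv (h * w') p.1 = p.2))} with hS
  have himg : cs.halfSep (lcoset (cs.parabolic I) g) (lcoset (cs.parabolic J) h) =
      (fun p : W × Bool => cs.halfSpace p.1 p.2) '' S := by
    ext H
    constructor
    · rintro ⟨⟨t, c, ht, rfl⟩, h1, h2⟩
      rw [cs.lcoset_subset_halfSpace_iff hw ht] at h1
      rw [cs.lcoset_subset_halfSpace_iff hw' ht] at h2
      exact ⟨(t, c), ⟨ht, h1, h2⟩, rfl⟩
    · rintro ⟨⟨t, c⟩, ⟨ht, h1, h2⟩, rfl⟩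
      refine ⟨⟨t, c, ht, rfl⟩, ?_, ?_⟩
      · rwa [cs.lcoset_subset_halfSpace_iff hw ht]
      · rwa [cs.lcoset_subset_halfSpace_iff hw' ht]
  have hinj : Set.InjOn (fun p : W × Bool => cs.halfSpace p.1 p.2) S := by
    rintro ⟨t, c⟩ ⟨ht, -⟩ ⟨t', c'⟩ ⟨ht', -⟩ he
    obtain ⟨rfl, rfl⟩ := cs.halfSpace_injective ht ht' he
    rfl
  have hST : S ⊆ ((T ×ˢ Finset.univ : Finset (W × Bool)) : Set (W × Bool)) := by
    rintro ⟨t, c⟩ ⟨ht, ⟨h1, -⟩, h2⟩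
    have : t ∈ T := by
      by_contra hn
      refine h2 ⟨?_, ?_⟩
      · by_contra hne
        exact hn (hsub ⟨ht, fun e => hne (e.symm.trans h1)⟩)
      · by_contra hne
        exact hn (hsub' ⟨ht, fun e => hne (e.symm.trans h1)⟩)
    simpa using this
  rw [himg, hinj.ncard_image, ncard_eq_sum hST, Finset.sum_product]
  refine Finset.sum_congr rfl fun t ht => ?_
  rw [wallCount]
  refine Finset.sum_congr rfl fun c _ => ?_
  have : (t, c) ∈ S ↔ ((cs.leftInv g t = c ∧ cs.leftInv (g * w) t = c) ∧
      ¬ (cs.leftInv h t = c ∧ cs.leftInv (h * w') t = c)) :=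
    ⟨fun h => h.2, fun h => ⟨hT t ht, h⟩⟩
  simp only [this]

theorem length_eq_sum {T : Finset W} (hT : ∀ t ∈ T, cs.IsReflection t)
    (hsub : cs.sepWalls g h ⊆ T) :
    cs.length (g⁻¹ * h) = ∑ t ∈ T, if cs.leftInv g t ≠ cs.leftInv h t then 1 else 0 := by
  classical
  rw [← ncard_sepWalls, ncard_eq_sum hsub]
  refine Finset.sum_congr rfl fun t ht => ?_
  have : t ∈ cs.sepWalls g h ↔ cs.leftInv g t ≠ cs.leftInv h t :=
    ⟨fun h => h.2, fun h => ⟨hT t ht, h⟩⟩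
  simp only [this]

theorem exists_walls (S : Finset (W × W)) :
    ∃ T : Finset W, (∀ t ∈ T, cs.IsReflection t) ∧ ∀ p ∈ S, cs.sepWalls p.1 p.2 ⊆ T := by
  have hfin : (⋃ p ∈ S, cs.sepWalls p.1 p.2).Finite :=
    S.finite_toSet.biUnion fun p _ => cs.finite_sepWalls p.1 p.2
  refine ⟨hfin.toFinset, fun t ht => ?_, fun p hp t ht => ?_⟩
  · simp only [Set.Finite.mem_toFinset, Set.mem_iUnion] at ht
    obtain ⟨p, -, ht⟩ := ht
    exact ht.1
  · simp only [Set.Finite.coe_toFinset, Set.mem_iUnion]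
    exact ⟨p, hp, ht⟩

theorem exists_walls_of_opp (hw : cs.IsOpp I w) (hw' : cs.IsOpp J w') (g h : W) :
    ∃ T : Finset W, (∀ t ∈ T, cs.IsReflection t) ∧
      cs.length (g⁻¹ * h) = (∑ t ∈ T, if cs.leftInv g t ≠ cs.leftInv h t then 1 else 0) ∧
      cs.length ((g * w)⁻¹ * (h * w')) =
        (∑ t ∈ T, if cs.leftInv (g * w) t ≠ cs.leftInv (h * w') t then 1 else 0) ∧
      cs.halfDist (lcoset (cs.parabolic I) g) (lcoset (cs.parabolic J) h) =
        ∑ t ∈ T, (wallCount (cs.leftInv g t) (cs.leftInv (g * w) t) (cs.leftInv h t)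
          (cs.leftInv (h * w') t) + wallCount (cs.leftInv h t) (cs.leftInv (h * w') t)
          (cs.leftInv g t) (cs.leftInv (g * w) t)) := by
  classical
  obtain ⟨T, hT, hsub⟩ := cs.exists_walls
    {(g, h), (g, h * w'), (h, g), (h, g * w), (g * w, h * w')}
  refine ⟨T, hT, cs.length_eq_sum hT (hsub (g, h) (by simp)),
    cs.length_eq_sum hT (hsub (g * w, h * w') (by simp)), ?_⟩
  rw [halfDist, cs.ncard_halfSep_lcoset hw hw' hT (hsub (g, h) (by simp))
    (hsub (g, h * w') (by simp)), cs.ncard_halfSep_lcoset hw' hw hT (hsub (h, g) (by simp))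
    (hsub (h, g * w) (by simp)), Finset.sum_add_distrib]

/-- The root-distance between two residues is at most the mean of the distances between two
pairs of opposite chambers. -/
theorem halfDist_lcoset_le (hw : cs.IsOpp I w) (hw' : cs.IsOpp J w') (g h : W) :
    cs.halfDist (lcoset (cs.parabolic I) g) (lcoset (cs.parabolic J) h) ≤
      cs.length (g⁻¹ * h) + cs.length ((g * w)⁻¹ * (h * w')) := by
  obtain ⟨T, -, h1, h2, h3⟩ := cs.exists_walls_of_opp hw hw' g h
  rw [h1, h2, h3, ← Finset.sum_add_distrib]
  refine Finset.sum_le_sum fun t _ => ?_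
  generalize cs.leftInv g t = a
  generalize cs.leftInv (g * w) t = a'
  generalize cs.leftInv h t = b
  generalize cs.leftInv (h * w') t = b'
  revert a a' b b'
  decide

/-- Equality holds in `halfDist_lcoset_le` if `h` is a projection of `g`. -/
theorem le_halfDist_lcoset (hw : cs.IsOpp I w) (hw' : cs.IsOpp J w') {g h : W}
    (hgh : ∀ q ∈ cs.parabolic J, cs.length (g⁻¹ * h) ≤ cs.length (g⁻¹ * h * q)) :
    cs.length (g⁻¹ * h) + cs.length ((g * w)⁻¹ * (h * w')) ≤
      cs.halfDist (lcoset (cs.parabolic I) g) (lcoset (cs.parabolic J) h) := by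
  obtain ⟨T, hT, h1, h2, h3⟩ := cs.exists_walls_of_opp hw hw' g h
  rw [h1, h2, h3, ← Finset.sum_add_distrib]
  refine Finset.sum_le_sum fun t ht => ?_
  have ht := hT t ht
  have hcut : cs.leftInv h t ≠ cs.leftInv (h * w') t → cs.leftInv g t = cs.leftInv h t := by
    intro hne
    by_contra hne'
    rw [← ne_eq, cs.leftInv_ne_iff ht] at hne'
    rw [cs.leftInv_ne_iff ht] at hne
    have ht' : cs.IsReflection (h⁻¹ * t * h) := by simpa using ht.conj h⁻¹
    have hmem : h⁻¹ * t * h ∈ cs.parabolic J :=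
      cs.mem_parabolic_of_length_lt hw'.1 ht' (by simpa [mul_assoc] using hne)
    have := hgh _ hmem
    have he : g⁻¹ * h * (h⁻¹ * t * h) = g⁻¹ * t * h := by group
    rw [he] at this
    omega
  revert hcut
  generalize cs.leftInv g t = a
  generalize cs.leftInv (g * w) t = a'
  generalize cs.leftInv h t = b
  generalize cs.leftInv (h * w') t = b'
  revert a a' b b'
  decide

end counting

/-- A coset of `W_I` is an intersection of half-spaces. -/
theorem exists_halfSpace_of_not_mem {I : Set B} {g v : W}
    (hv : v ∉ lcoset (cs.parabolic I) g) :
    ∃ H, cs.IsHalfSpace H ∧ lcoset (cs.parabolic I) g ⊆ H ∧ v ∉ H := by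
  obtain ⟨u, hu, hmin⟩ := cs.exists_minimal (cs.parabolic I) (v⁻¹ * g)
  set x := v⁻¹ * g * u with hx
  have hne : x ≠ 1 := by
    intro h
    refine hv ?_
    have : g⁻¹ * v = u := by
      calc g⁻¹ * v = u * x⁻¹ := by rw [hx]; group
        _ = u := by rw [h]; simp
    rwa [mem_lcoset, this]
  obtain ⟨i, hi⟩ := cs.exists_rightDescent_of_ne_one hne
  have hi' : cs.length (x * cs.simple i) < cs.length x := hi
  have hs : cs.simple i ∉ cs.parabolic I := fun h => (hmin _ h).not_gt hi'
  have ht : cs.IsReflection (g * u * cs.simple i * (g * u)⁻¹) := ⟨_, _, rfl⟩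
  set t := g * u * cs.simple i * (g * u)⁻¹ with ht_def
  refine ⟨cs.halfSpace t (cs.leftInv (g * u) t), ⟨_, _, ht, rfl⟩, fun p hp => ?_, fun h => ?_⟩
  · by_contra hn
    have h1 := (cs.leftInv_ne_iff ht (g * u) p).1 (Ne.symm hn)
    refine hs (cs.mem_parabolic_of_length_lt (u := u⁻¹ * (g⁻¹ * p))
      (mul_mem (inv_mem hu) hp) (cs.isReflection_simple i) ?_)
    simpa [ht_def, mul_assoc] using h1
  · refine (cs.leftInv_ne_iff ht (g * u) v).2 ?_ (Eq.symm h)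
    have e1 : (g * u)⁻¹ * v = x⁻¹ := by rw [hx]; group
    have e2 : (g * u)⁻¹ * t * v = (x * cs.simple i)⁻¹ := by
      rw [hx, ht_def]; simp [mul_assoc]
    rwa [e1, e2, length_inv, length_inv]

theorem lcoset_subset_of_halfSep_eq_empty {I J : Set B} {g h : W}
    (he : cs.halfSep (lcoset (cs.parabolic I) g) (lcoset (cs.parabolic J) h) = ∅) :
    lcoset (cs.parabolic J) h ⊆ lcoset (cs.parabolic I) g := by
  intro v hv
  by_contra hn
  obtain ⟨H, hH, hsub, hvH⟩ := cs.exists_halfSpace_of_not_mem hn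
  exact Set.eq_empty_iff_forall_notMem.1 he H ⟨hH, hsub, fun h => hvH (h hv)⟩

theorem lcoset_finite {I : Set B} (hI : SphType cs I) (g : W) :
    (lcoset (cs.parabolic I) g).Finite :=
  Set.Finite.preimage (mul_right_injective g⁻¹).injOn hI

theorem lcoset_eq_of_mem {P : Subgroup W} {g h : W} (hh : h ∈ lcoset P g) :
    lcoset P g = lcoset P h := by
  ext v
  rw [mem_lcoset, mem_lcoset, ← Subgroup.mul_mem_cancel_left P (inv_mem hh)]
  simp [mul_assoc]

theorem image_mul_lcoset (P : Subgroup W) (k g : W) :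
    (k * ·) '' lcoset P g = lcoset P (k * g) := by
  ext v
  simp [lcoset, mul_assoc]

end CoxeterSystem

namespace Bldg

variable {cs : CoxeterSystem M W} (X : Bldg cs)

/-! ### Galleries and the Weyl distance -/

theorem delta_self (C : X.Chamber) : X.delta C C = 1 := (X.delta_eq_one_iff C C).2 rfl

theorem delta_symm_of_simple {C D : X.Chamber} {i : B} (h : X.delta C D = cs.simple i) :
    X.delta D C = cs.simple i := by
  have := X.delta_mem_pair D C D i h
  rw [X.delta_self] at this
  rcases this with h' | h'
  · rw [eq_comm, mul_eq_one_iff_eq_inv] at h'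
    simpa using h'
  · rw [eq_comm, X.delta_eq_one_iff] at h'
    subst h'
    exact h

/-- Galleries of a given type. -/
inductive Gallery : List B → X.Chamber → X.Chamber → Prop
  | nil (C : X.Chamber) : Gallery [] C C
  | snoc {ω : List B} {C D E : X.Chamber} {i : B} :
      Gallery ω C D → X.delta D E = cs.simple i → Gallery (ω ++ [i]) C E

variable {X}

theorem Gallery.cons {ω : List B} {C D E : X.Chamber} {i : B} (hCD : X.delta C D = cs.simple i)
    (h : X.Gallery ω D E) : X.Gallery (i :: ω) C E := by
  induction h with
  | nil D => exact (Gallery.nil C).snoc hCD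
  | snoc _ hs ih => exact (ih hCD).snoc hs

theorem Gallery.reverse {ω : List B} {C D : X.Chamber} (h : X.Gallery ω C D) :
    X.Gallery ω.reverse D C := by
  induction h with
  | nil C => exact Gallery.nil C
  | snoc _ hs ih =>
    rw [List.reverse_append]
    exact ih.cons (X.delta_symm_of_simple hs)

theorem Gallery.delta_eq {ω : List B} {C D : X.Chamber} (h : X.Gallery ω C D)
    (hω : cs.IsReduced ω) : X.delta C D = cs.wordProd ω := by
  induction h with
  | nil C => simpa using X.delta_self C
  | @snoc ω C D E i _ hs ih =>
    have hlen : cs.length (cs.wordProd ω * cs.simple i) = ω.length + 1 := by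
      simpa [CoxeterSystem.wordProd_append] using hω.eq
    have h1 := cs.length_mul_le (cs.wordProd ω) (cs.simple i)
    have h2 := cs.length_wordProd_le ω
    rw [cs.length_simple] at h1
    have hred : cs.length (cs.wordProd ω) = ω.length := by omega
    have hδ := ih hred
    rw [X.delta_eq_of_length C D E i hs (by rw [hδ, hlen, hred]), hδ,
      CoxeterSystem.wordProd_append, CoxeterSystem.wordProd_singleton]

theorem exists_gallery (ω : List B) {C D : X.Chamber} (h : X.delta C D = cs.wordProd ω) :
    X.Gallery ω C D := by
  induction ω using List.reverseRecOn generalizing D with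
  | nil =>
    rw [CoxeterSystem.wordProd_nil, X.delta_eq_one_iff] at h
    exact h ▸ Gallery.nil C
  | append_singleton ω i ih =>
    obtain ⟨E, hE, hCE⟩ := X.exists_delta C D i
    refine (ih (D := E) ?_).snoc (X.delta_symm_of_simple hE)
    rw [hCE, h, CoxeterSystem.wordProd_append, CoxeterSystem.wordProd_singleton]
    simp

theorem delta_symm (C D : X.Chamber) : X.delta D C = (X.delta C D)⁻¹ := by
  obtain ⟨ω, hω, h⟩ := cs.exists_isReduced (X.delta C D)
  rw [(exists_gallery ω h).reverse.delta_eq hω.reverse, h, CoxeterSystem.wordProd_reverse]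

theorem Gallery.delta_eq_mul {ω : List B} {D E : X.Chamber} (h : X.Gallery ω D E)
    (C : X.Chamber) : ∃ y, X.delta C E = X.delta C D * y ∧ cs.length y ≤ ω.length ∧
      ∀ I : Set B, (∀ i ∈ ω, i ∈ I) → y ∈ cs.parabolic I := by
  induction h with
  | nil D => exact ⟨1, by simp, by simp, fun I _ => one_mem _⟩
  | @snoc ω D E F i _ hs ih =>
    obtain ⟨y, hy, hlen, hI⟩ := ih
    rcases X.delta_mem_pair C E F i hs with h | h
    · refine ⟨y * cs.simple i, by rw [h, hy, mul_assoc], ?_, fun I hωI => ?_⟩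
      · have := cs.length_mul_le y (cs.simple i)
        rw [cs.length_simple] at this
        simp only [List.length_append, List.length_singleton]
        omega
      · exact mul_mem (hI I fun j hj => hωI j (by simp [hj]))
          (Subgroup.subset_closure ⟨i, hωI i (by simp), rfl⟩)
    · refine ⟨y, by rw [h, hy], ?_, fun I hωI => hI I fun j hj => hωI j (by simp [hj])⟩
      simp only [List.length_append]
      omega

/-- Retractions do not increase the gallery distance. -/
theorem length_inv_delta_mul_delta_le (C D E : X.Chamber) :
    cs.length ((X.delta C D)⁻¹ * X.delta C E) ≤ cs.length (X.delta D E) := by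
  obtain ⟨ω, hω, h⟩ := cs.exists_isReduced (X.delta D E)
  obtain ⟨y, hy, hlen, -⟩ := (exists_gallery ω h).delta_eq_mul C
  rw [hy, inv_mul_cancel_left, h, hω.eq]
  exact hlen

theorem inv_delta_mul_delta_mem {I : Set B} {D E : X.Chamber}
    (hDE : X.delta D E ∈ cs.parabolic I) (C : X.Chamber) :
    (X.delta C D)⁻¹ * X.delta C E ∈ cs.parabolic I := by
  obtain ⟨ω, hω, h⟩ := cs.exists_word_of_mem_parabolic hDE
  obtain ⟨y, hy, -, hI⟩ := (exists_gallery ω h.symm).delta_eq_mul C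
  rw [hy, inv_mul_cancel_left]
  exact hI I hω

theorem exists_gallery_delta_eq (ω : List B) (C D : X.Chamber) :
    ∃ E, X.Gallery ω D E ∧ X.delta C E = X.delta C D * cs.wordProd ω := by
  induction ω using List.reverseRecOn with
  | nil => exact ⟨D, Gallery.nil D, by simp⟩
  | append_singleton ω i ih =>
    obtain ⟨E, hE, hCE⟩ := ih
    obtain ⟨F, hF, hCF⟩ := X.exists_delta C E i
    exact ⟨F, hE.snoc hF, by simp [hCF, hCE, CoxeterSystem.wordProd_append, mul_assoc]⟩

/-! ### Residues -/

theorem mem_residue {I : Set B} {C D : X.Chamber} :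
    D ∈ X.residue I C ↔ X.delta C D ∈ cs.parabolic I := Iff.rfl

theorem mem_residue_self (I : Set B) (C : X.Chamber) : C ∈ X.residue I C := by
  rw [mem_residue, delta_self]
  exact one_mem _

theorem residue_eq_of_mem {I : Set B} {C D : X.Chamber} (h : D ∈ X.residue I C) :
    X.residue I C = X.residue I D := by
  have key : ∀ {C D : X.Chamber}, D ∈ X.residue I C → X.residue I D ⊆ X.residue I C := by
    intro C D h E hE
    rw [mem_residue] at h hE ⊢
    simpa using mul_mem h (inv_delta_mul_delta_mem hE C)
  refine (key ?_).antisymm (key h)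
  rw [mem_residue, delta_symm]
  exact inv_mem h

theorem exists_mem_residue_delta_eq {I : Set B} {u : W} (hu : u ∈ cs.parabolic I)
    (C D : X.Chamber) : ∃ E ∈ X.residue I D, X.delta C E = X.delta C D * u := by
  obtain ⟨ω, hω, rfl⟩ := cs.exists_word_of_mem_parabolic hu
  obtain ⟨E, hE, h⟩ := exists_gallery_delta_eq ω C D
  refine ⟨E, ?_, h⟩
  obtain ⟨y, hy, -, hI⟩ := hE.delta_eq_mul D
  rw [mem_residue, hy, delta_self, one_mul]
  exact hI I hω

/-- Existence of the projection of a chamber to a residue. -/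
theorem exists_proj (I : Set B) (C D : X.Chamber) :
    ∃ P ∈ X.residue I D, ∀ E ∈ X.residue I D, X.delta C E = X.delta C P * X.delta P E := by
  obtain ⟨u, hu, hmin⟩ := cs.exists_minimal (cs.parabolic I) (X.delta C D)
  obtain ⟨P, hP, hCP⟩ := exists_mem_residue_delta_eq hu C D
  refine ⟨P, hP, fun E hE => ?_⟩
  rw [residue_eq_of_mem hP, mem_residue] at hE
  rw [← hCP] at hmin
  induction hn : cs.length (X.delta P E) generalizing E with
  | zero =>
    rw [cs.length_eq_zero_iff, X.delta_eq_one_iff] at hn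
    rw [hn, delta_self, mul_one]
  | succ n ih =>
    obtain ⟨i, hi⟩ := cs.exists_rightDescent_of_ne_one (w := X.delta P E)
      (by intro h; simp [h] at hn)
    have hs := cs.simple_mem_parabolic_of_isRightDescent hE hi
    have hlen := cs.isRightDescent_iff.1 hi
    obtain ⟨F, hEF, hPF⟩ := X.exists_delta P E i
    have hF : X.delta P F ∈ cs.parabolic I := by rw [hPF]; exact mul_mem hE hs
    have hCF := ih F hF (by rw [hPF]; omega)
    have hPE : X.delta P E = X.delta P F * cs.simple i := by rw [hPF]; simp
    have l1 := cs.length_mul_of_minimal hmin hE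
    have l2 := cs.length_mul_of_minimal hmin hF
    rw [X.delta_eq_of_length C F E i (X.delta_symm_of_simple hEF), hCF, hPE, mul_assoc]
    rw [hCF, l2, mul_assoc, ← hPE, l1, hPF]
    omega

/-! ### Apartments -/

/-- `G` is the graph of an isometry from a subset of `W` to `X`. -/
def IsPartialApart (G : Set (W × X.Chamber)) : Prop :=
  ∀ p ∈ G, ∀ q ∈ G, X.delta p.2 q.2 = p.1⁻¹ * q.1

theorem IsPartialApart.exists_extension {G : Set (W × X.Chamber)} (hG : IsPartialApart G)
    {g : W} {C : X.Chamber} (hC : (g, C) ∈ G) (i : B) :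
    ∃ E, ∀ p ∈ G, X.delta p.2 E = p.1⁻¹ * (g * cs.simple i) := by
  have hlong : ∀ E, X.delta C E = cs.simple i → ∀ p ∈ G,
      cs.length (p.1⁻¹ * g * cs.simple i) = cs.length (p.1⁻¹ * g) + 1 →
      X.delta p.2 E = p.1⁻¹ * (g * cs.simple i) := by
    intro E hE p hp hlen
    have hpC := hG p hp _ hC
    rw [← mul_assoc, ← hpC]
    exact X.delta_eq_of_length _ _ _ _ hE (by rw [hpC]; exact hlen)
  by_cases hex : ∃ p ∈ G, cs.length (p.1⁻¹ * g * cs.simple i) + 1 = cs.length (p.1⁻¹ * g)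
  · obtain ⟨p, hp, hlen⟩ := hex
    have hpC := hG p hp _ hC
    obtain ⟨E, hCE, hpE⟩ := X.exists_delta p.2 C i
    refine ⟨E, fun q hq => ?_⟩
    have hqC := hG q hq _ hC
    rcases cs.length_mul_simple (q.1⁻¹ * g) i with hl | hl
    · exact hlong E hCE q hq hl
    rcases X.delta_mem_pair q.2 C E i hCE with h | h
    · rw [h, hqC, mul_assoc]
    exfalso
    obtain ⟨F, hCF, hqF⟩ := X.exists_delta q.2 C i
    have hEF : X.delta E F = cs.simple i := by
      have hEC := X.delta_symm_of_simple hCE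
      rcases X.delta_mem_pair E C F i hCF with h' | h'
      · rw [hEC, cs.simple_mul_simple_self, X.delta_eq_one_iff] at h'
        rw [← h', h] at hqF
        have := cs.length_mul_simple_ne (X.delta q.2 C) i
        rw [← hqF] at this
        exact absurd rfl this
      · rw [h', hEC]
    have hpF : X.delta p.2 F = p.1⁻¹ * g := by
      rw [X.delta_eq_of_length p.2 E F i hEF, hpE, hpC]
      · simp
      · rw [hpE, hpC]
        simpa using hlen.symm
    have hle := length_inv_delta_mul_delta_le p.2 F q.2
    rw [hpF, hG p hp q hq, delta_symm q.2 F, hqF, hqC, cs.length_inv] at hle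
    have he : (p.1⁻¹ * g)⁻¹ * (p.1⁻¹ * q.1) = (q.1⁻¹ * g)⁻¹ := by group
    rw [he, cs.length_inv] at hle
    dsimp only at hle
    omega
  · obtain ⟨E, hCE, -⟩ := X.exists_delta C C i
    refine ⟨E, fun q hq => hlong E hCE q hq ?_⟩
    rcases cs.length_mul_simple (q.1⁻¹ * g) i with hl | hl
    exacts [hl, absurd ⟨q, hq, hl⟩ hex]

theorem IsPartialApart.insert {G : Set (W × X.Chamber)} (hG : IsPartialApart G) {g : W}
    {E : X.Chamber} (hE : ∀ p ∈ G, X.delta p.2 E = p.1⁻¹ * g) :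
    IsPartialApart (insert (g, E) G) := by
  rintro p (rfl | hp) q (rfl | hq)
  · simp [delta_self]
  · rw [delta_symm q.2, hE q hq]; group
  · exact hE p hp
  · exact hG p hp q hq

theorem IsPartialApart.exists_apartMap {G : Set (W × X.Chamber)} (hG : IsPartialApart G)
    (hne : G.Nonempty) : ∃ α, X.IsApartMap α ∧ ∀ p ∈ G, α p.1 = p.2 := by
  obtain ⟨N, hGN, hmax⟩ := zorn_subset_nonempty {N : Set (W × X.Chamber) | IsPartialApart N} (by
    intro c hc hchain _
    refine ⟨⋃₀ c, ?_, fun s hs => Set.subset_sUnion_of_mem hs⟩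
    rintro p ⟨s, hs, hp⟩ q ⟨t, ht, hq⟩
    rcases hchain.total hs ht with h | h
    exacts [hc ht p (h hp) q hq, hc hs p hp q (h hq)]) G hG
  have hN : IsPartialApart N := hmax.prop
  have hstep : ∀ g, (∃ C, (g, C) ∈ N) → ∀ i, ∃ C, (g * cs.simple i, C) ∈ N := by
    rintro g ⟨C, hC⟩ i
    obtain ⟨E, hE⟩ := hN.exists_extension hC i
    exact ⟨E, hmax.le_of_ge (hN.insert hE) (Set.subset_insert _ _) (Set.mem_insert _ _)⟩
  have hall : ∀ g, ∃ C, (g, C) ∈ N := by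
    obtain ⟨⟨g₀, C₀⟩, h₀⟩ := hne
    have hw : ∀ w, ∃ C, (g₀ * w, C) ∈ N := by
      intro w
      induction w using cs.simple_induction_right with
      | one => exact ⟨C₀, by simpa using hGN h₀⟩
      | mul_simple_right w i ih => rw [← mul_assoc]; exact hstep _ ih i
    intro g
    simpa using hw (g₀⁻¹ * g)
  choose α hα using hall
  have hδ : ∀ v w, X.delta (α v) (α w) = v⁻¹ * w := fun v w => hN _ (hα v) _ (hα w)
  refine ⟨α, ⟨fun v w h => ?_, hδ⟩, fun p hp => ?_⟩
  · have := hδ v w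
    rw [h, delta_self, eq_comm, inv_mul_eq_one] at this
    exact this
  · rw [← X.delta_eq_one_iff, hN _ (hα p.1) p (hGN hp)]
    simp

/-- Any two chambers lie in a common apartment. -/
theorem exists_apartMap (C D : X.Chamber) :
    ∃ α, X.IsApartMap α ∧ α 1 = C ∧ α (X.delta C D) = D := by
  have h : IsPartialApart {((1 : W), C), (X.delta C D, D)} := by
    rintro p (rfl | rfl) q (rfl | rfl) <;> simp [delta_self, delta_symm C D]
  obtain ⟨α, hα, hαG⟩ := h.exists_apartMap ⟨_, Or.inl rfl⟩
  exact ⟨α, hα, hαG (1, C) (by simp), hαG (X.delta C D, D) (by simp)⟩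

end Bldg

namespace Bldg

variable {cs : CoxeterSystem M W} {X : Bldg cs}

open CoxeterSystem

/-! ### Roots of an apartment -/

theorem IsApartMap.comp_mul_left {α : W → X.Chamber} (hα : X.IsApartMap α) (k : W) :
    X.IsApartMap fun v => α (k * v) :=
  ⟨fun v w h => mul_left_cancel (hα.1 h), fun v w => by rw [hα.2]; group⟩

theorem range_comp_mul_left (α : W → X.Chamber) (k : W) :
    Set.range (fun v => α (k * v)) = Set.range α :=
  (Group.mulLeft_bijective k).surjective.range_comp α

theorem IsApartMap.eq_of_apply_eq {α β : W → X.Chamber} (hα : X.IsApartMap α)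
    (hβ : X.IsApartMap β) (h : Set.range β ⊆ Set.range α) {k : W} (hk : α k = β 1) (v : W) :
    β v = α (k * v) := by
  obtain ⟨m, hm⟩ := h ⟨v, rfl⟩
  have := hβ.2 1 v
  rw [← hk, ← hm, hα.2, inv_one, one_mul, inv_mul_eq_iff_eq_mul] at this
  rw [← hm, this]

theorem isRootOf_range_iff {α : W → X.Chamber} (hα : X.IsApartMap α) {φ : Set X.Chamber} :
    X.IsRootOf (Set.range α) φ ↔ ∃ H, cs.IsHalfSpace H ∧ φ = α '' H := by
  constructor
  · rintro ⟨β, hβ, hr, t, ht, rfl⟩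
    obtain ⟨k, hk⟩ : β 1 ∈ Set.range α := hr ▸ ⟨1, rfl⟩
    refine ⟨_, (cs.isHalfSpace_iff_exists_translate _).2 ⟨k⁻¹, t, ht, rfl⟩, ?_⟩
    ext C
    constructor
    · rintro ⟨v, hv, rfl⟩
      exact ⟨k * v, by simpa using hv, (hα.eq_of_apply_eq hβ hr.ge hk v).symm⟩
    · rintro ⟨v, hv, rfl⟩
      exact ⟨k⁻¹ * v, hv, by simp [hα.eq_of_apply_eq hβ hr.ge hk]⟩
  · rintro ⟨H, hH, rfl⟩
    obtain ⟨g, t, ht, rfl⟩ := (cs.isHalfSpace_iff_exists_translate _).1 hH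
    refine ⟨_, hα.comp_mul_left g⁻¹, (range_comp_mul_left α _).symm, t, ht, ?_⟩
    ext C
    constructor
    · rintro ⟨v, hv, rfl⟩
      exact ⟨g * v, hv, by simp⟩
    · rintro ⟨v, hv, rfl⟩
      exact ⟨g⁻¹ * v, by simpa using hv, rfl⟩

theorem containedInRoot_image_iff {α : W → X.Chamber} (hα : X.IsApartMap α) (R : X.Res)
    (H : Set W) : X.ContainedInRoot R (Set.range α) (α '' H) ↔ α ⁻¹' R.1 ⊆ H := by
  constructor
  · intro h v hv
    exact hα.1.mem_set_image.1 (h ⟨hv, v, rfl⟩)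
  · rintro h _ ⟨hv, v, rfl⟩
    exact ⟨v, h hv, rfl⟩

theorem phiSep_range {α : W → X.Chamber} (hα : X.IsApartMap α) (R₁ R₂ : X.Res) :
    X.PhiSep (Set.range α) R₁ R₂ = (α '' ·) '' cs.halfSep (α ⁻¹' R₁.1) (α ⁻¹' R₂.1) := by
  ext φ
  constructor
  · rintro ⟨hφ, h1, h2⟩
    obtain ⟨H, hH, rfl⟩ := (isRootOf_range_iff hα).1 hφ
    rw [containedInRoot_image_iff hα] at h1 h2
    exact ⟨H, ⟨hH, h1, h2⟩, rfl⟩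
  · rintro ⟨H, ⟨hH, h1, h2⟩, rfl⟩
    rw [← containedInRoot_image_iff hα] at h1 h2
    exact ⟨(isRootOf_range_iff hα).2 ⟨H, hH, rfl⟩, h1, h2⟩

theorem ncard_phiSep_range {α : W → X.Chamber} (hα : X.IsApartMap α) (R₁ R₂ : X.Res) :
    (X.PhiSep (Set.range α) R₁ R₂).ncard = (cs.halfSep (α ⁻¹' R₁.1) (α ⁻¹' R₂.1)).ncard := by
  rw [phiSep_range hα]
  exact Set.ncard_image_of_injective _ hα.1.image_injective

/-! ### The root-distance -/

theorem IsApartMap.preimage_residue {α : W → X.Chamber} (hα : X.IsApartMap α) (I : Set B)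
    (g : W) : α ⁻¹' X.residue I (α g) = lcoset (cs.parabolic I) g := by
  ext v
  rw [Set.mem_preimage, mem_residue, hα.2, mem_lcoset]

theorem exists_eq_residue_of_mem (R : X.Res) {C : X.Chamber} (hC : C ∈ R.1) :
    ∃ I, SphType cs I ∧ R.1 = X.residue I C := by
  obtain ⟨I, D, hI, hR⟩ := R.2
  exact ⟨I, hI, hR.trans (residue_eq_of_mem (hR ▸ hC))⟩

theorem liesIn_range_iff {α : W → X.Chamber} {R : X.Res} :
    X.LiesIn R (Set.range α) ↔ ∃ g, α g ∈ R.1 :=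
  ⟨fun ⟨_, h, g, hg⟩ => ⟨g, hg ▸ h⟩, fun ⟨g, h⟩ => ⟨α g, h, g, rfl⟩⟩

theorem exists_preimage_eq_lcoset {α : W → X.Chamber} (hα : X.IsApartMap α) {R : X.Res} {g : W}
    (hg : α g ∈ R.1) : ∃ I, SphType cs I ∧ R.1 = X.residue I (α g) ∧
      α ⁻¹' R.1 = lcoset (cs.parabolic I) g := by
  obtain ⟨I, hI, hR⟩ := exists_eq_residue_of_mem R hg
  exact ⟨I, hI, hR, by rw [hR, hα.preimage_residue]⟩

theorem nonempty_preimage {α : W → X.Chamber} {R : X.Res} (hR : X.LiesIn R (Set.range α)) :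
    (α ⁻¹' R.1).Nonempty := liesIn_range_iff.1 hR

theorem finite_preimage {α : W → X.Chamber} (hα : X.IsApartMap α) {R : X.Res}
    (hR : X.LiesIn R (Set.range α)) : (α ⁻¹' R.1).Finite := by
  obtain ⟨g, hg⟩ := liesIn_range_iff.1 hR
  obtain ⟨I, hI, -, h⟩ := exists_preimage_eq_lcoset hα hg
  exact h ▸ cs.lcoset_finite hI g

/-- The traces of two residues on two apartments differ by a translation. -/
theorem exists_translate {α β : W → X.Chamber} (hα : X.IsApartMap α) (hβ : X.IsApartMap β)
    {R₁ R₂ : X.Res} (h₁ : X.LiesIn R₁ (Set.range α)) (h₂ : X.LiesIn R₂ (Set.range α))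
    (h₁' : X.LiesIn R₁ (Set.range β)) (h₂' : X.LiesIn R₂ (Set.range β)) :
    ∃ k : W, (k * ·) '' (α ⁻¹' R₁.1) = β ⁻¹' R₁.1 ∧ (k * ·) '' (α ⁻¹' R₂.1) = β ⁻¹' R₂.1 := by
  obtain ⟨g, hg⟩ := liesIn_range_iff.1 h₁
  obtain ⟨h, hh⟩ := liesIn_range_iff.1 h₂
  obtain ⟨g', hg'⟩ := liesIn_range_iff.1 h₁'
  obtain ⟨h', hh'⟩ := liesIn_range_iff.1 h₂'
  obtain ⟨I, -, hI, hα₁⟩ := exists_preimage_eq_lcoset hα hg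
  obtain ⟨J, -, hJ, hα₂⟩ := exists_preimage_eq_lcoset hα hh
  have hp : (X.delta (α h) (α g))⁻¹ * X.delta (α h) (β g') ∈ cs.parabolic I :=
    inv_delta_mul_delta_mem (mem_residue.1 (hI ▸ hg')) _
  have hq : (X.delta (β g') (α h))⁻¹ * X.delta (β g') (β h') ∈ cs.parabolic J :=
    inv_delta_mul_delta_mem (mem_residue.1 (hJ ▸ hh')) _
  have hβ₁ : β ⁻¹' R₁.1 = lcoset (cs.parabolic I) g' := by
    rw [hI, residue_eq_of_mem (hI ▸ hg'), hβ.preimage_residue]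
  have hβ₂ : β ⁻¹' R₂.1 = lcoset (cs.parabolic J) h' := by
    rw [hJ, residue_eq_of_mem (hJ ▸ hh'), hβ.preimage_residue]
  set y := X.delta (α h) (β g') with hy
  refine ⟨g' * y⁻¹ * h⁻¹, ?_, ?_⟩
  · rw [hα₁, hβ₁, image_mul_lcoset]
    refine (lcoset_eq_of_mem ?_).symm
    rw [hα.2] at hp
    rw [mem_lcoset]
    simpa [mul_assoc] using inv_mem hp
  · rw [hα₂, hβ₂, image_mul_lcoset]
    refine lcoset_eq_of_mem ?_
    rw [hβ.2, delta_symm (α h), ← hy] at hq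
    rw [mem_lcoset]
    simpa [mul_assoc] using hq

theorem ncard_halfSep_preimage_eq {α β : W → X.Chamber} (hα : X.IsApartMap α)
    (hβ : X.IsApartMap β) {R₁ R₂ : X.Res} (h₁ : X.LiesIn R₁ (Set.range α))
    (h₂ : X.LiesIn R₂ (Set.range α)) (h₁' : X.LiesIn R₁ (Set.range β))
    (h₂' : X.LiesIn R₂ (Set.range β)) :
    (cs.halfSep (α ⁻¹' R₁.1) (α ⁻¹' R₂.1)).ncard =
      (cs.halfSep (β ⁻¹' R₁.1) (β ⁻¹' R₂.1)).ncard := by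
  obtain ⟨k, hk₁, hk₂⟩ := exists_translate hα hβ h₁ h₂ h₁' h₂'
  rw [← hk₁, ← hk₂, ncard_halfSep_translate]

theorem res_nonempty (R : X.Res) : R.1.Nonempty := by
  obtain ⟨I, C, -, hR⟩ := R.2
  exact ⟨C, hR ▸ mem_residue_self I C⟩

theorem exists_common_apartMap (R₁ R₂ : X.Res) :
    ∃ α, X.IsApartMap α ∧ X.LiesIn R₁ (Set.range α) ∧ X.LiesIn R₂ (Set.range α) := by
  obtain ⟨C, hC⟩ := res_nonempty R₁
  obtain ⟨D, hD⟩ := res_nonempty R₂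
  obtain ⟨α, hα, h1, h2⟩ := exists_apartMap C D
  exact ⟨α, hα, ⟨C, hC, 1, h1⟩, ⟨D, hD, _, h2⟩⟩

theorem rootDist_eq {α : W → X.Chamber} (hα : X.IsApartMap α) {R₁ R₂ : X.Res}
    (h₁ : X.LiesIn R₁ (Set.range α)) (h₂ : X.LiesIn R₂ (Set.range α)) :
    X.rootDist R₁ R₂ = (cs.halfDist (α ⁻¹' R₁.1) (α ⁻¹' R₂.1) : ℝ) / 2 := by
  have hex : ∃ A, X.IsApartment A ∧ X.LiesIn R₁ A ∧ X.LiesIn R₂ A :=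
    ⟨_, ⟨α, hα, rfl⟩, h₁, h₂⟩
  obtain ⟨⟨β, hβ, hA⟩, h₁', h₂'⟩ := Classical.epsilon_spec hex
  change X.chooseApt R₁ R₂ = _ at hA
  change X.LiesIn R₁ (X.chooseApt R₁ R₂) at h₁'
  change X.LiesIn R₂ (X.chooseApt R₁ R₂) at h₂'
  rw [hA] at h₁' h₂'
  rw [rootDist, hA, ncard_phiSep_range hβ, ncard_phiSep_range hβ, halfDist,
    ncard_halfSep_preimage_eq hα hβ h₁ h₂ h₁' h₂', ncard_halfSep_preimage_eq hα hβ h₂ h₁ h₂' h₁']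

theorem rootDist_comm (R₁ R₂ : X.Res) : X.rootDist R₁ R₂ = X.rootDist R₂ R₁ := by
  obtain ⟨α, hα, h₁, h₂⟩ := exists_common_apartMap R₁ R₂
  rw [rootDist_eq hα h₁ h₂, rootDist_eq hα h₂ h₁, halfDist, halfDist, add_comm]

theorem rootDist_eq_zero_iff (R₁ R₂ : X.Res) : X.rootDist R₁ R₂ = 0 ↔ R₁ = R₂ := by
  obtain ⟨α, hα, h₁, h₂⟩ := exists_common_apartMap R₁ R₂
  rw [rootDist_eq hα h₁ h₂, div_eq_zero_iff, or_iff_left two_ne_zero, Nat.cast_eq_zero,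
    halfDist, Nat.add_eq_zero_iff,
    Set.ncard_eq_zero (cs.finite_halfSep (nonempty_preimage h₁) (finite_preimage hα h₂)),
    Set.ncard_eq_zero (cs.finite_halfSep (nonempty_preimage h₂) (finite_preimage hα h₁))]
  constructor
  · rintro ⟨h, h'⟩
    obtain ⟨g, hg⟩ := liesIn_range_iff.1 h₁
    obtain ⟨k, hk⟩ := liesIn_range_iff.1 h₂
    obtain ⟨I, -, hI, hα₁⟩ := exists_preimage_eq_lcoset hα hg
    obtain ⟨J, -, -, hα₂⟩ := exists_preimage_eq_lcoset hα hk
    rw [hα₁, hα₂] at h h'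
    have heq := (cs.lcoset_subset_of_halfSep_eq_empty h').antisymm
      (cs.lcoset_subset_of_halfSep_eq_empty h)
    have hgR : α g ∈ R₂.1 := by
      change g ∈ α ⁻¹' R₂.1
      rw [hα₂, ← heq, ← hα₁]
      exact hg
    obtain ⟨K, -, hK, hα₃⟩ := exists_preimage_eq_lcoset hα hgR
    refine Subtype.ext ?_
    have hIK : cs.parabolic I = cs.parabolic K := by
      ext u
      have := Set.ext_iff.1 (heq.trans (hα₂.symm.trans hα₃)) (g * u)
      simpa [mem_lcoset] using this
    ext E
    rw [hI, hK, mem_residue, mem_residue, hIK]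
  · rintro rfl
    exact ⟨Set.eq_empty_of_forall_notMem fun H h => h.2.2 h.2.1,
      Set.eq_empty_of_forall_notMem fun H h => h.2.2 h.2.1⟩

/-! ### Retractions -/

theorem sphType_of_residue_eq {I J : Set B} {C D : X.Chamber}
    (h : X.residue I C = X.residue J D) (hI : SphType cs I) : SphType cs J := by
  have hC : D ∈ X.residue I C := h ▸ mem_residue_self J D
  refine Set.Finite.subset hI fun u hu => ?_
  obtain ⟨E, hE, hDE⟩ := exists_mem_residue_delta_eq (X := X) hu D D
  rw [← h, residue_eq_of_mem hC, mem_residue, hDE, delta_self, one_mul] at hE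
  exact hE

theorem retrRes_spec (α : W → X.Chamber) (R : X.Res) :
    ∃ I D, SphType cs I ∧ R.1 = X.residue I D ∧
      (X.retrRes α R).1 = X.residue I (X.retr α D) := by
  obtain ⟨I, D, hI, hR⟩ := R.2
  have hex : ∃ T : X.Res, ∃ (I : Set B) (D : X.Chamber), R.1 = X.residue I D ∧
      T.1 = X.residue I (X.retr α D) :=
    ⟨⟨X.residue I (X.retr α D), I, _, hI, rfl⟩, I, D, hR, rfl⟩
  obtain ⟨J, E, hJ, hT⟩ := Classical.epsilon_spec hex
  exact ⟨J, E, sphType_of_residue_eq (hR.symm.trans hJ) hI, hJ, hT⟩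

theorem liesIn_retrRes (α : W → X.Chamber) (R : X.Res) :
    X.LiesIn (X.retrRes α R) (Set.range α) := by
  obtain ⟨I, D, -, -, h⟩ := retrRes_spec α R
  exact ⟨X.retr α D, h ▸ mem_residue_self I _, _, rfl⟩

theorem IsApartMap.preimage_residue_delta {α : W → X.Chamber} (hα : X.IsApartMap α) {I : Set B}
    {D E : X.Chamber} (hE : E ∈ X.residue I D) :
    α ⁻¹' X.residue I (X.retr α D) = lcoset (cs.parabolic I) (X.delta (α 1) E) := by
  rw [retr, hα.preimage_residue]
  exact lcoset_eq_of_mem (inv_delta_mul_delta_mem hE (α 1))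

theorem retrRes_eq_self {α : W → X.Chamber} (hα : X.IsApartMap α) {R : X.Res}
    (hR : X.LiesIn R (Set.range α)) : X.retrRes α R = R := by
  obtain ⟨g, hg⟩ := liesIn_range_iff.1 hR
  obtain ⟨I, D, -, hI, h⟩ := retrRes_spec α R
  rw [hI] at hg
  have hmem := inv_delta_mul_delta_mem hg (α 1)
  refine Subtype.ext ?_
  rw [h, hI, residue_eq_of_mem hg]
  refine residue_eq_of_mem ?_
  rw [hα.2] at hmem
  rw [mem_residue, retr, hα.2]
  simpa using hmem

theorem rootDist_retrRes_le {α : W → X.Chamber} (hα : X.IsApartMap α) (R₁ R₂ : X.Res) :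
    X.rootDist (X.retrRes α R₁) (X.retrRes α R₂) ≤ X.rootDist R₁ R₂ := by
  obtain ⟨I, C, hI, hR₁, hT₁⟩ := retrRes_spec α R₁
  obtain ⟨J, D, hJ, hR₂, hT₂⟩ := retrRes_spec α R₂
  obtain ⟨p₁, hp₁, hproj₁⟩ := exists_proj I (α 1) C
  obtain ⟨p₂, hp₂, hproj₂⟩ := exists_proj J (α 1) D
  obtain ⟨β, hβ, hβ₁, hβ₂⟩ := exists_apartMap p₁ p₂
  set k := X.delta p₁ p₂ with hk
  obtain ⟨w, hw⟩ := cs.exists_longest hI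
  obtain ⟨w', hw'⟩ := cs.exists_longest hJ
  obtain ⟨q, hq, hmin⟩ := cs.exists_minimal (cs.parabolic J) k
  have hd₁ : ∀ u ∈ cs.parabolic I, X.delta (α 1) (β u) = X.delta (α 1) p₁ * u := by
    intro u hu
    have h : X.delta p₁ (β u) = u := by rw [← hβ₁, hβ.2, inv_one, one_mul]
    rw [hproj₁ (β u), h]
    rw [residue_eq_of_mem hp₁, mem_residue, h]
    exact hu
  have hd₂ : ∀ u ∈ cs.parabolic J, X.delta (α 1) (β (k * u)) = X.delta (α 1) p₂ * u := by
    intro u hu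
    have h : X.delta p₂ (β (k * u)) = u := by rw [← hβ₂, hβ.2, inv_mul_cancel_left]
    rw [hproj₂ (β (k * u)), h]
    rw [residue_eq_of_mem hp₂, mem_residue, h]
    exact hu
  have hB₁ : β ⁻¹' R₁.1 = lcoset (cs.parabolic I) 1 := by
    rw [hR₁, residue_eq_of_mem hp₁, ← hβ₁, hβ.preimage_residue]
  have hB₂ : β ⁻¹' R₂.1 = lcoset (cs.parabolic J) (k * q) := by
    rw [hR₂, residue_eq_of_mem hp₂, ← hβ₂, hβ.preimage_residue]
    exact lcoset_eq_of_mem (by simpa [mem_lcoset] using hq)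
  have hA₁ : α ⁻¹' (X.retrRes α R₁).1 = lcoset (cs.parabolic I) (X.delta (α 1) p₁) := by
    rw [hT₁, hα.preimage_residue_delta hp₁]
  have hA₂ : α ⁻¹' (X.retrRes α R₂).1 = lcoset (cs.parabolic J) (X.delta (α 1) p₂ * q) := by
    rw [hT₂, hα.preimage_residue_delta hp₂]
    exact lcoset_eq_of_mem (by simpa [mem_lcoset] using hq)
  rw [rootDist_eq hα (liesIn_retrRes α R₁) (liesIn_retrRes α R₂),
    rootDist_eq hβ ⟨p₁, hR₁ ▸ hp₁, _, hβ₁⟩ ⟨p₂, hR₂ ▸ hp₂, _, hβ₂⟩, hA₁, hA₂, hB₁, hB₂]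
  have hl₁ := length_inv_delta_mul_delta_le (α 1) (β 1) (β (k * q))
  rw [hd₂ q hq, hβ₁, ← hβ₁, hβ.2, hβ₁] at hl₁
  have hl₂ := length_inv_delta_mul_delta_le (α 1) (β w) (β (k * (q * w')))
  rw [hd₁ w hw.1, hd₂ _ (mul_mem hq hw'.1), hβ.2] at hl₂
  have hle := (cs.halfDist_lcoset_le hw hw' (X.delta (α 1) p₁) (X.delta (α 1) p₂ * q)).trans
    ((add_le_add hl₁ (by simpa only [mul_assoc, one_mul] using hl₂)).trans
      (cs.le_halfDist_lcoset hw hw' (g := 1) (h := k * q) fun u hu => by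
        simpa using hmin u hu))
  have : (cs.halfDist (lcoset (cs.parabolic I) (X.delta (α 1) p₁))
      (lcoset (cs.parabolic J) (X.delta (α 1) p₂ * q)) : ℝ) ≤
      cs.halfDist (lcoset (cs.parabolic I) 1) (lcoset (cs.parabolic J) (k * q)) := mod_cast hle
  linarith

theorem rootDist_triangle_of_liesIn {α : W → X.Chamber} (hα : X.IsApartMap α) {R₁ R₂ R₃ : X.Res}
    (h₁ : X.LiesIn R₁ (Set.range α)) (h₂ : X.LiesIn R₂ (Set.range α))
    (h₃ : X.LiesIn R₃ (Set.range α)) :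
    X.rootDist R₁ R₃ ≤ X.rootDist R₁ R₂ + X.rootDist R₂ R₃ := by
  rw [rootDist_eq hα h₁ h₂, rootDist_eq hα h₁ h₃, rootDist_eq hα h₂ h₃, ← add_div]
  have h := cs.ncard_halfSep_triangle (nonempty_preimage h₁) (nonempty_preimage h₂)
    (finite_preimage hα h₂) (finite_preimage hα h₃)
  have h' := cs.ncard_halfSep_triangle (nonempty_preimage h₃) (nonempty_preimage h₂)
    (finite_preimage hα h₂) (finite_preimage hα h₁)
  gcongr
  norm_cast
  simp only [halfDist]
  omega

theorem rootDist_triangle (R₁ R₂ R₃ : X.Res) :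
    X.rootDist R₁ R₃ ≤ X.rootDist R₁ R₂ + X.rootDist R₂ R₃ := by
  obtain ⟨α, hα, h₁, h₃⟩ := exists_common_apartMap R₁ R₃
  have h := rootDist_retrRes_le hα R₁ R₂
  have h' := rootDist_retrRes_le hα R₂ R₃
  rw [retrRes_eq_self hα h₁] at h
  rw [retrRes_eq_self hα h₃] at h'
  exact (rootDist_triangle_of_liesIn hα h₁ (liesIn_retrRes α R₂) h₃).trans (add_le_add h h')

end Bldg

/-- The root-distance on `Res(X)` is well defined (independent of the
apartment), is a metric (symmetric, vanishing exactly on the diagonal, triangle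
inequality), and retractions onto apartments do not increase it. -/
theorem statement0 {cs : CoxeterSystem M W} (X : Bldg cs) :
    (∀ (R₁ R₂ : X.Res) (A A' : Set X.Chamber),
      X.IsApartment A → X.LiesIn R₁ A → X.LiesIn R₂ A →
      X.IsApartment A' → X.LiesIn R₁ A' → X.LiesIn R₂ A' →
      (X.PhiSep A R₁ R₂).ncard = (X.PhiSep A' R₁ R₂).ncard ∧
      (X.PhiSep A R₂ R₁).ncard = (X.PhiSep A' R₂ R₁).ncard) ∧
    (∀ R₁ R₂ : X.Res, X.rootDist R₁ R₂ = X.rootDist R₂ R₁) ∧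
    (∀ R₁ R₂ : X.Res, X.rootDist R₁ R₂ = 0 ↔ R₁ = R₂) ∧
    (∀ R₁ R₂ R₃ : X.Res, X.rootDist R₁ R₃ ≤ X.rootDist R₁ R₂ + X.rootDist R₂ R₃) ∧
    (∀ α : W → X.Chamber, X.IsApartMap α →
      ∀ R₁ R₂ : X.Res, X.rootDist (X.retrRes α R₁) (X.retrRes α R₂) ≤ X.rootDist R₁ R₂) := by
  refine ⟨?_, Bldg.rootDist_comm, Bldg.rootDist_eq_zero_iff, Bldg.rootDist_triangle,
    fun α hα => Bldg.rootDist_retrRes_le hα⟩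
  rintro R₁ R₂ _ _ ⟨α, hα, rfl⟩ h₁ h₂ ⟨β, hβ, rfl⟩ h₁' h₂'
  simp only [Bldg.ncard_phiSep_range hα, Bldg.ncard_phiSep_range hβ]
  exact ⟨Bldg.ncard_halfSep_preimage_eq hα hβ h₁ h₂ h₁' h₂',
    Bldg.ncard_halfSep_preimage_eq hα hβ h₂ h₁ h₂' h₁'⟩
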